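/- Let T be a (4,1)-tree on N vertices with DFS preorder x_1, …, x_N. Then for all integers i, m ≥ 0 with i + m ≤ N, the induced subgraph of G²_T on the interval {x_{i+1}, …, x_{i+m}} contains every tree on m vertices. -/

import Mathlib

/-- A DFS-ordered rooted tree on the vertices `0, 1, …, N-1`, listed in DFS preorder
(the root is `0` and the children of each vertex are ordered by their labels).
It is encoded by its parent function: `parent j < j` for every non-root vertex `j`, and the
labelling is a DFS preorder exactly when the parent of each vertex `j ≥ 1` is `j - 1` or an
ancestor of `j - 1`. By convention `parent 0 = 0`. -/
structure DFSTree (N : ℕ) : Type where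
  parent : ℕ → ℕ
  parent_zero : parent 0 = 0
  parent_lt : ∀ j, 0 < j → j < N → parent j < j
  preorder_chain : ∀ j, 0 < j → j < N → ∃ k, parent^[k] (j - 1) = parent j

namespace DFSTree

variable {N : ℕ}

/-- The level `L u` of a vertex `u`: its distance to the root `0`. -/
noncomputable def level (T : DFSTree N) (u : ℕ) : ℕ :=
  sInf {k | T.parent^[k] u = 0}

/-- `D[u]`: the set of descendants of `u`, including `u` itself. -/
def descCl (T : DFSTree N) (u : ℕ) : Set ℕ :=
  {w | w < N ∧ ∃ k, T.parent^[k] w = u}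

/-- `w ∈ D(u)`: `w` is a strict descendant of `u`. -/
def StrictDesc (T : DFSTree N) (u w : ℕ) : Prop :=
  w ∈ T.descCl u ∧ w ≠ u

/-- `w` is a left-sibling of `u`. -/
def LeftSib (T : DFSTree N) (u w : ℕ) : Prop :=
  0 < w ∧ w < u ∧ T.parent w = T.parent u

/-- `w = l u` is the nearest left-cousin of `u`: the last vertex before `u` in the DFS order
having the same level as `u`. -/
def Nlc (T : DFSTree N) (u w : ℕ) : Prop :=
  w < u ∧ T.level w = T.level u ∧ ∀ c, w < c → c < u → T.level c ≠ T.level u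

/-- `w = r u` is the nearest right-cousin of `u`: the first vertex after `u` in the DFS order
having the same level as `u`. -/
def Nrc (T : DFSTree N) (u w : ℕ) : Prop :=
  u < w ∧ w < N ∧ T.level w = T.level u ∧ ∀ c, u < c → c < w → T.level c ≠ T.level u

/-- The arc relation generating `G^h_T`: rules (G1)–(G4). -/
def Arc (T : DFSTree N) (h : ℕ) (u w : ℕ) : Prop :=
  -- (G1) w ∈ D(u)
  T.StrictDesc u w
  -- (G2) w is a left-sibling of u, or a strict descendant of a left-sibling of u
  ∨ (∃ s, T.LeftSib u s ∧ (w = s ∨ T.StrictDesc s w))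
  -- (G3) w = l(u*) (u* the parent of u), or a strict descendant of l(u*)
  ∨ (0 < u ∧ ∃ s, T.Nlc (T.parent u) s ∧ (w = s ∨ T.StrictDesc s w))
  -- (G4) with u' the h-th ancestor of u
  ∨ (w = T.parent^[h] u
      ∨ T.Nlc (T.parent^[h] u) w
      ∨ T.Nrc (T.parent^[h] u) w
      ∨ (((∃ s, T.Nlc (T.parent^[h] u) s ∧ T.StrictDesc s w)
            ∨ T.StrictDesc (T.parent^[h] u) w
            ∨ (∃ s, T.Nrc (T.parent^[h] u) s ∧ T.StrictDesc s w))
          ∧ T.level w ≤ T.level u))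

/-- The graph `G^h_T` that is `h`-generated by `T`, as a simple graph on `ℕ` all of whose
edges lie within the vertex set `{0, …, N-1}` of `T`. -/
def graph (T : DFSTree N) (h : ℕ) : SimpleGraph ℕ :=
  SimpleGraph.fromRel (fun u w => u < N ∧ w < N ∧ T.Arc h u w)

/-- `T` is a `(K, s)`-tree: conditions (T1)–(T4), where `ν u = |D[u]|`. -/
def IsKSTree (T : DFSTree N) (K s : ℕ) : Prop :=
  ∀ u, u < N →
    -- (T1) if l(l(u)) exists then ν(l(l(u))) + ν(l(u)) ≥ ν(u)
    ((∀ a b, T.Nlc u a → T.Nlc a b →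
        (T.descCl u).ncard ≤ (T.descCl b).ncard + (T.descCl a).ncard) ∧
     -- (T2) if l(u) exists then K·ν(l(u)) ≥ ν(u)
     (∀ a, T.Nlc u a → (T.descCl u).ncard ≤ K * (T.descCl a).ncard) ∧
     -- (T3) if u is not the rightmost vertex of its level then ν(u) ≥ ν(u')
     -- for every u' with L(u') ≥ L(u) + s
     ((∃ w, u < w ∧ w < N ∧ T.level w = T.level u) →
        ∀ u', u' < N → T.level u + s ≤ T.level u' →
          (T.descCl u').ncard ≤ (T.descCl u).ncard) ∧
     -- (T4) if u has a child and l(u) exists then l(u) has a child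
     ((∃ c, 0 < c ∧ c < N ∧ T.parent c = u) →
        ∀ a, T.Nlc u a → ∃ c', 0 < c' ∧ c' < N ∧ T.parent c' = a))

end DFSTree

namespace DFSTree

variable {N : ℕ} (T : DFSTree N)

theorem exists_iterate_parent_eq_zero {j : ℕ} (hj : j < N) : ∃ k, T.parent^[k] j = 0 := by
  induction j using Nat.strong_induction_on with
  | _ j ih =>
    rcases Nat.eq_zero_or_pos j with rfl | h
    · exact ⟨0, rfl⟩
    · have := T.parent_lt j h hj
      obtain ⟨k, hk⟩ := ih _ this (by omega)
      exact ⟨k + 1, by simpa [Function.iterate_succ_apply] using hk⟩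

theorem level_zero : T.level 0 = 0 := by
  have : T.level 0 ≤ 0 := Nat.sInf_le (by simp)
  omega

theorem level_eq_succ {j : ℕ} (h0 : 0 < j) (hj : j < N) :
    T.level j = T.level (T.parent j) + 1 := by
  have hp : T.parent j < N := (T.parent_lt j h0 hj).trans hj
  have h1 : T.parent^[T.level (T.parent j)] (T.parent j) = 0 :=
    Nat.sInf_mem (s := {k | T.parent^[k] (T.parent j) = 0}) (T.exists_iterate_parent_eq_zero hp)
  have h2 : T.parent^[T.level j] j = 0 :=
    Nat.sInf_mem (s := {k | T.parent^[k] j = 0}) (T.exists_iterate_parent_eq_zero hj)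
  have h3 : T.level j ≤ T.level (T.parent j) + 1 :=
    Nat.sInf_le (by simpa [Function.iterate_succ_apply] using h1)
  rcases Nat.eq_zero_or_pos (T.level j) with h | h
  · rw [h] at h2
    simp at h2
    omega
  · have h4 : T.level (T.parent j) ≤ T.level j - 1 := by
      apply Nat.sInf_le
      obtain ⟨k, hk⟩ := Nat.exists_eq_succ_of_ne_zero h.ne'
      rw [hk] at h2 ⊢
      simpa [Function.iterate_succ_apply] using h2
    omega

theorem level_pos {j : ℕ} (h0 : 0 < j) (hj : j < N) : 0 < T.level j := by
  rw [T.level_eq_succ h0 hj]; omega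

theorem parent_le {j : ℕ} (hj : j < N) : T.parent j ≤ j := by
  rcases Nat.eq_zero_or_pos j with rfl | h
  · simp [T.parent_zero]
  · exact (T.parent_lt j h hj).le

theorem iterate_parent_le {j : ℕ} (hj : j < N) (k : ℕ) : T.parent^[k] j ≤ j := by
  induction k with
  | zero => simp
  | succ k ih =>
    rw [Function.iterate_succ_apply']
    exact (T.parent_le (by omega)).trans ih

theorem level_iterate_parent {j : ℕ} (hj : j < N) (k : ℕ) :
    T.level (T.parent^[k] j) = T.level j - k := by
  induction k with
  | zero => simp
  | succ k ih =>
    rw [Function.iterate_succ_apply']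
    have h1 := T.iterate_parent_le hj k
    rcases Nat.eq_zero_or_pos (T.parent^[k] j) with h | h
    · rw [h, T.level_zero] at ih
      rw [h, T.parent_zero, T.level_zero]; omega
    · have := T.level_eq_succ h (by omega)
      omega

theorem level_le_pred_succ {j : ℕ} (h0 : 0 < j) (hj : j < N) :
    T.level j ≤ T.level (j - 1) + 1 := by
  obtain ⟨k, hk⟩ := T.preorder_chain j h0 hj
  have := T.level_iterate_parent (j := j - 1) (by omega) k
  rw [hk] at this
  rw [T.level_eq_succ h0 hj]; omega

theorem level_lt_of_iterate_parent {x : ℕ} (hx : x < N) (k : ℕ) {z : ℕ}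
    (hz : T.parent^[k] x < z) (hzx : z ≤ x) : T.level (T.parent^[k] x) < T.level z := by
  induction x using Nat.strong_induction_on generalizing k z with
  | _ x ih =>
    rcases Nat.eq_zero_or_pos x with rfl | h0
    · have := T.iterate_parent_le hx k; omega
    cases k with
    | zero => simp at hz; omega
    | succ k =>
      rw [Function.iterate_succ_apply] at hz ⊢
      have hl := T.level_eq_succ h0 hx
      have hp := T.parent_lt x h0 hx
      have h2 := T.level_iterate_parent (j := T.parent x) (by omega) k
      rcases hzx.eq_or_lt with rfl | hlt
      · omega
      · obtain ⟨m, hm⟩ := T.preorder_chain x h0 hx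
        rw [← hm, ← Function.iterate_add_apply] at hz ⊢
        exact ih (x - 1) (by omega) (by omega) (k + m) hz (by omega)

theorem exists_iterate_parent_eq {b x : ℕ} (hbx : b ≤ x) (hx : x < N)
    (h : ∀ z, b < z → z ≤ x → T.level b < T.level z) : ∃ k, T.parent^[k] x = b := by
  induction x using Nat.strong_induction_on with
  | _ x ih =>
    rcases hbx.eq_or_lt with rfl | hlt
    · exact ⟨0, rfl⟩
    have h0 : 0 < x := by omega
    have hp := T.parent_lt x h0 hx
    have hle : b ≤ T.parent x := by
      by_contra hcon
      have h1 := T.level_lt_of_iterate_parent hx 1 (z := b) (by simp; omega) hlt.le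
      have h2 := h x hlt le_rfl
      have h3 := T.level_eq_succ h0 hx
      simp at h1; omega
    obtain ⟨k, hk⟩ := ih _ hp hle (by omega) fun z hz hz' => h z hz (by omega)
    exact ⟨k + 1, by rw [Function.iterate_succ_apply]; exact hk⟩

theorem mem_descCl_iff {b x : ℕ} (hx : x < N) :
    x ∈ T.descCl b ↔ b ≤ x ∧ ∀ z, b < z → z ≤ x → T.level b < T.level z := by
  constructor
  · rintro ⟨_, k, rfl⟩
    exact ⟨T.iterate_parent_le hx k, fun z hz hzx => T.level_lt_of_iterate_parent hx k hz hzx⟩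
  · rintro ⟨h1, h2⟩
    exact ⟨hx, T.exists_iterate_parent_eq h1 hx h2⟩

theorem strictDesc_iff {b x : ℕ} (hx : x < N) :
    T.StrictDesc b x ↔ b < x ∧ ∀ z, b < z → z ≤ x → T.level b < T.level z := by
  rw [StrictDesc, T.mem_descCl_iff hx]
  constructor
  · rintro ⟨⟨h1, h2⟩, h3⟩; exact ⟨by omega, h2⟩
  · rintro ⟨h1, h2⟩; exact ⟨⟨h1.le, h2⟩, h1.ne'⟩

theorem exists_level_eq {x y m : ℕ} (hxy : x ≤ y) (hy : y < N) (hx : T.level x ≤ m)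
    (hm : m ≤ T.level y) : ∃ z, x ≤ z ∧ z ≤ y ∧ T.level z = m := by
  induction y with
  | zero => exact ⟨0, by omega, le_rfl, by
      obtain rfl : x = 0 := by omega
      omega⟩
  | succ y ih =>
    by_cases hm' : m = T.level (y + 1)
    · exact ⟨y + 1, hxy, le_rfl, hm'.symm⟩
    have := T.level_le_pred_succ (j := y + 1) (by omega) hy
    simp at this
    have hxy' : x ≤ y := by
      by_contra hc
      obtain rfl : x = y + 1 := by omega
      omega
    obtain ⟨z, h1, h2, h3⟩ := ih hxy' (by omega) (by omega)
    exact ⟨z, h1, by omega, h3⟩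

/-- Levels increase by at most one along the preorder, so a segment that starts above level `m`
and avoids level `m` stays above level `m`. -/
theorem level_lt_of_forall_ne {b x m : ℕ} (hx : x < N) (hm : m < T.level x)
    (h : ∀ z, b < z → z ≤ x → T.level z ≠ m) {z : ℕ} (hz : b < z) (hzx : z ≤ x) :
    m < T.level z := by
  by_contra hc
  obtain ⟨y, h1, h2, h3⟩ := T.exists_level_eq hzx hx (m := m) (by omega) hm.le
  exact h y (by omega) h2 h3

theorem strictDesc_of_forall_ne {b x m : ℕ} (hbx : b < x) (hx : x < N) (hb : T.level b = m)
    (hm : m < T.level x) (h : ∀ z, b < z → z ≤ x → T.level z ≠ m) : T.StrictDesc b x := by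
  rw [T.strictDesc_iff hx]
  exact ⟨hbx, fun z hz hzx => hb ▸ T.level_lt_of_forall_ne hx hm h hz hzx⟩

/-- The last vertex of level `m` up to `x`. -/
theorem exists_last_level {x m : ℕ} (hx : x < N) (hm : m ≤ T.level x) :
    ∃ z, z ≤ x ∧ T.level z = m ∧ ∀ y, z < y → y ≤ x → m < T.level y := by
  obtain ⟨z0, -, h2, h3⟩ := T.exists_level_eq (Nat.zero_le x) hx (m := m)
    (by rw [T.level_zero]; omega) hm
  classical
  let P : ℕ → Prop := fun z => z ≤ x ∧ T.level z = m
  refine ⟨Nat.findGreatest P x, (Nat.findGreatest_spec (P := P) h2 ⟨h2, h3⟩).1,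
    (Nat.findGreatest_spec (P := P) h2 ⟨h2, h3⟩).2, ?_⟩
  intro y hy hyx
  have key : ∀ z, Nat.findGreatest P x < z → z ≤ x → T.level z ≠ m := fun z hz hzx hl =>
    Nat.findGreatest_is_greatest hz hzx ⟨hzx, hl⟩
  rcases hm.eq_or_lt with hmx | hlt
  · exact absurd hmx.symm (key x (by omega) le_rfl)
  · exact T.level_lt_of_forall_ne hx hlt key hy hyx

theorem parent_spec {u : ℕ} (h0 : 0 < u) (hu : u < N) :
    T.parent u < u ∧ T.level (T.parent u) + 1 = T.level u ∧
      ∀ z, T.parent u < z → z ≤ u → T.level u ≤ T.level z := by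
  refine ⟨T.parent_lt u h0 hu, (T.level_eq_succ h0 hu).symm, fun z hz hzu => ?_⟩
  have := T.level_lt_of_iterate_parent hu 1 (z := z) (by simpa using hz) hzu
  rw [T.level_eq_succ h0 hu]
  simpa using this

/-- A vertex is the parent of `u` if it is the last one before `u` on the previous level. -/
theorem parent_eq_of_level {u p : ℕ} (hu : u < N) (hpu : p < u)
    (hl : T.level p + 1 = T.level u) (h : ∀ z, p < z → z < u → T.level z ≠ T.level p) :
    T.parent u = p := by
  obtain ⟨h1, h2, h3⟩ := T.parent_spec (by omega) hu
  rcases lt_trichotomy (T.parent u) p with hlt | heq | hgt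
  · have := h3 p hlt hpu.le; omega
  · exact heq
  · exact absurd (by omega) (h _ hgt h1)

end DFSTree

namespace DFSTree

variable {N : ℕ} (T : DFSTree N)

/-- The vertices of level at least `l` in the interval `[s, e)`. -/
noncomputable def block (l s e : ℕ) : Finset ℕ :=
  (Finset.Ico s e).filter (l ≤ T.level ·)

/-- At most one vertex of `[s, e)` lies on the level just above `l`. -/
def UniqueAbove (l s e : ℕ) : Prop :=
  ∀ x y, s ≤ x → x < e → s ≤ y → y < e → T.level x + 1 = l → T.level y + 1 = l → x = y

variable {T}

theorem mem_block {l s e x : ℕ} : x ∈ T.block l s e ↔ s ≤ x ∧ x < e ∧ l ≤ T.level x := by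
  simp [block, and_assoc]

theorem UniqueAbove.mono {l s e s' e' : ℕ} (h : T.UniqueAbove l s e) (hs : s ≤ s') (he : e' ≤ e) :
    T.UniqueAbove l s' e' :=
  fun x y h1 h2 h3 h4 => h x y (by omega) (by omega) (by omega) (by omega)

theorem adj_of_arc {u w : ℕ} (hu : u < N) (hw : w < N) (hne : u ≠ w) (h : T.Arc 2 u w) :
    (T.graph 2).Adj u w :=
  ⟨hne, Or.inl ⟨hu, hw, h⟩⟩

theorem exists_nlc_strictDesc {l s e x p : ℕ} (he : e ≤ N) (hU : T.UniqueAbove l s e)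
    (hs : s ≤ x) (hxp : x < p) (hp : p < e) (hpl : T.level p + 1 = l) (hx : l ≤ T.level x) :
    ∃ g, T.Nlc p g ∧ T.StrictDesc g x := by
  obtain ⟨g, h1, h2, h3⟩ := T.exists_last_level (x := x) (m := T.level p) (by omega) (by omega)
  have hgx : g ≠ x := by rintro rfl; omega
  refine ⟨g, ⟨by omega, h2, fun c hc hcp hcl => ?_⟩, ?_⟩
  · rcases le_or_gt c x with hcx | hcx
    · have := h3 c hc hcx; omega
    · have := hU c p (by omega) (by omega) (by omega) hp (by omega) hpl
      omega
  · rw [T.strictDesc_iff (by omega)]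
    exact ⟨by omega, fun z hz hzx => h2 ▸ h3 z hz hzx⟩

/-- The last vertex of level `l` in an interval with at most one vertex on the level just above
is adjacent to every other vertex of the block. -/
theorem adj_last {l s e u x : ℕ} (he : e ≤ N) (hU : T.UniqueAbove l s e)
    (hue : u < e) (hul : T.level u = l)
    (hlast : ∀ y, u < y → y < e → T.level y ≠ l) (hx : x ∈ T.block l s e) (hne : u ≠ x) :
    (T.graph 2).Adj u x := by
  rw [mem_block] at hx
  obtain ⟨hsx, hxe, hxl⟩ := hx
  apply adj_of_arc (by omega) (by omega) hne
  rcases lt_or_gt_of_ne hne with hux | hxu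
  · left
    refine T.strictDesc_of_forall_ne hux (by omega) hul ?_ fun z hz hzx => hlast z hz (by omega)
    have := hlast x hux hxe
    omega
  · right
    have hu0 : 0 < u := by omega
    obtain ⟨h1, h2, h3⟩ := T.parent_spec hu0 (by omega)
    have hpx : T.parent u ≠ x := by rintro h; rw [h] at h2; omega
    rcases lt_or_gt_of_ne hpx with hlt | hgt
    · left
      obtain ⟨w, hw1, hw2, hw3⟩ := T.exists_last_level (x := x) (m := l) (by omega) hxl
      obtain ⟨z, hz1, hz2, hz3⟩ := T.exists_level_eq (x := T.parent u) (y := x) (m := l)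
        (by omega) (by omega) (by omega) hxl
      have hpw : T.parent u < w := by
        by_contra hc
        have : z ≠ T.parent u := by rintro rfl; omega
        have := hw3 z (by omega) hz2
        omega
      refine ⟨w, ⟨by omega, by omega, ?_⟩, ?_⟩
      · refine T.parent_eq_of_level (by omega) hpw (by omega) fun z hz hzw => ?_
        have := h3 z hz (by omega)
        omega
      · rcases hw1.eq_or_lt with rfl | hlt
        · exact Or.inl rfl
        · right
          rw [T.strictDesc_iff (by omega)]
          exact ⟨hlt, fun z hz hzx => hw2 ▸ hw3 z hz hzx⟩
    · right; left
      obtain ⟨g, hg1, hg2⟩ := exists_nlc_strictDesc he hU hsx hgt (by omega) (by omega) hxl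
      exact ⟨hu0, g, hg1, Or.inr hg2⟩

/-- Two vertices of level `l + 1` in an interval with at most one vertex of level `l - 1` are
adjacent. -/
theorem adj_of_level_succ {l s e x y : ℕ} (he : e ≤ N) (hU : T.UniqueAbove l s e)
    (hsx : s ≤ x) (hxy : x < y) (hye : y < e) (hx : T.level x = l + 1) (hy : T.level y = l + 1) :
    (T.graph 2).Adj x y := by
  symm
  apply adj_of_arc (by omega) (by omega) (by omega)
  right; right; right; right; right; right
  refine ⟨?_, by omega⟩
  have hle := T.iterate_parent_le (j := y) (by omega) 2
  have hlv := T.level_iterate_parent (j := y) (by omega) 2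
  have hlt := fun z => T.level_lt_of_iterate_parent (x := y) (by omega) 2 (z := z)
  set g := T.parent^[2] y with hg
  have hgx : g ≠ x := by rintro rfl; omega
  rcases lt_or_gt_of_ne hgx with h | h
  · right; left
    rw [T.strictDesc_iff (by omega)]
    exact ⟨h, fun z hz hzx => hlt z hz (by omega)⟩
  · rcases Nat.eq_zero_or_pos l with rfl | hl
    · have := T.level_pos (j := g) (by omega) (by omega)
      omega
    · left
      have hgy : g ≠ y := by intro h; rw [h] at hlv; omega
      exact exists_nlc_strictDesc he hU hsx h (by omega) (by omega) (by omega)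

/-- A vertex is adjacent to the nearest left-cousin of its parent. -/
theorem adj_nlc_parent {a u b : ℕ} (hb : b < N) (hub : u < b)
    (hn : T.Nlc u a) (hl : T.level b = T.level u + 1)
    (h : ∀ z, u < z → z < b → T.level z ≠ T.level u) : (T.graph 2).Adj a b := by
  symm
  have hp := T.parent_eq_of_level hb hub hl.symm h
  have := hn.1
  apply adj_of_arc hb (by omega) (by omega)
  right; right; left
  exact ⟨by omega, a, hp.symm ▸ hn, Or.inl rfl⟩

/-- A block of `k` vertices or more has an initial segment with exactly `k` vertices. -/
theorem exists_card_block_left {l s e k : ℕ} (hse : s ≤ e) (hk : k ≤ (T.block l s e).card) :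
    ∃ t, s ≤ t ∧ t ≤ e ∧ (T.block l s t).card = k := by
  induction e with
  | zero =>
    refine ⟨s, le_rfl, hse, ?_⟩
    obtain rfl : s = 0 := by omega
    simp [block] at hk ⊢
    omega
  | succ e ih =>
    rcases hk.eq_or_lt with rfl | hlt
    · exact ⟨e + 1, hse, le_rfl, rfl⟩
    rcases hse.eq_or_lt with rfl | hse'
    · simp [block] at hlt
    have hsub : T.block l s (e + 1) ⊆ insert e (T.block l s e) := by
      intro x; simp only [Finset.mem_insert, mem_block]; omega
    have h1 := Finset.card_le_card hsub
    have h2 := Finset.card_insert_le e (T.block l s e)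
    obtain ⟨t, ht1, ht2, ht3⟩ := ih (by omega) (by omega)
    exact ⟨t, ht1, by omega, ht3⟩

theorem card_block_add {l s t e : ℕ} (hst : s ≤ t) (hte : t ≤ e) :
    (T.block l s t).card + (T.block l t e).card = (T.block l s e).card := by
  rw [← Finset.card_union_of_disjoint]
  · congr 1; ext x; simp only [Finset.mem_union, mem_block]; omega
  · rw [Finset.disjoint_left]; intro x; simp only [mem_block]; omega

theorem exists_card_block_right {l s e k : ℕ} (hse : s ≤ e) (hk : k ≤ (T.block l s e).card) :
    ∃ t, s ≤ t ∧ t ≤ e ∧ (T.block l t e).card = k := by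
  obtain ⟨t, h1, h2, h3⟩ := exists_card_block_left (T := T) (l := l)
    (k := (T.block l s e).card - k) hse (by omega)
  have := card_block_add (T := T) (l := l) h1 h2
  exact ⟨t, h1, h2, by omega⟩

end DFSTree

section RootedForest

variable {V : Type*} [DecidableEq V] {G : SimpleGraph V}

/-- The sets `D k`, `k ∈ K`, are disjoint pieces of `S`, attached to the rest of `S` only through
an edge from `k` to the vertex `y`. -/
structure Branching (G : SimpleGraph V) (y : V) (K : Finset V) (D : V → Finset V)
    (S : Finset V) : Prop where
  disj : ∀ k ∈ K, ∀ k' ∈ K, k ≠ k' → Disjoint (D k) (D k')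
  mem : ∀ k ∈ K, k ∈ D k
  notMem : ∀ k ∈ K, y ∉ D k
  out : ∀ k ∈ K, ∀ x ∈ D k, ∀ z ∈ S, z ∉ D k → G.Adj x z → x = k ∧ z = y

/-- The edges of `G` inside `S` form a subgraph of a tree on `S` rooted at `r`. -/
inductive RTree (G : SimpleGraph V) : V → Finset V → Prop
  | node (r : V) (K : Finset V) (D : V → Finset V) :
      Branching G r K D (insert r (K.biUnion D)) → (∀ k ∈ K, RTree G k (D k)) →
      RTree G r (insert r (K.biUnion D))

theorem RTree.singleton (r : V) : RTree G r {r} := by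
  have := RTree.node (G := G) r ∅ (fun _ => ∅) ⟨by simp, by simp, by simp, by simp⟩ (by simp)
  simpa using this

theorem RTree.insert_leaf {r : V} {S : Finset V} (h : RTree G r S) {p x : V} (hp : p ∈ S)
    (hx : x ∉ S) (hadj : ∀ z ∈ S, G.Adj x z → z = p) : RTree G r (insert x S) := by
  induction h with
  | node r K D hB hK ih =>
    by_cases hpr : p = r
    · subst hpr
      have hxK : x ∉ K := fun hk => hx (by
        simp only [Finset.mem_insert, Finset.mem_biUnion]; exact Or.inr ⟨x, hk, hB.mem x hk⟩)
      have hD : ∀ k ∈ K, Function.update D x {x} k = D k := fun k hk =>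
        Function.update_of_ne (by rintro rfl; exact hxK hk) _ _
      have hU : (insert x K).biUnion (Function.update D x {x}) = insert x (K.biUnion D) := by
        rw [Finset.biUnion_insert, Finset.biUnion_congr rfl hD]; simp
      have hxD : ∀ k ∈ K, x ∉ D k := fun k hk hxk => hx (by
        simp only [Finset.mem_insert, Finset.mem_biUnion]; exact Or.inr ⟨k, hk, hxk⟩)
      have hxp : x ≠ p := by rintro rfl; simp at hx
      have := RTree.node (G := G) p (insert x K) (Function.update D x {x}) ?_ ?_
      · rwa [hU, Finset.insert_comm] at this
      · rw [hU]
        constructor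
        · intro k hk k' hk' hne
          rw [Finset.mem_insert] at hk hk'
          rcases hk with rfl | hk <;> rcases hk' with rfl | hk'
          · exact absurd rfl hne
          · rw [hD _ hk']; simpa using hxD _ hk'
          · rw [hD _ hk]; simpa using hxD _ hk
          · rw [hD _ hk, hD _ hk']; exact hB.disj _ hk _ hk' hne
        · intro k hk
          rw [Finset.mem_insert] at hk
          rcases hk with rfl | hk
          · simp
          · rw [hD _ hk]; exact hB.mem _ hk
        · intro k hk
          rw [Finset.mem_insert] at hk
          rcases hk with rfl | hk
          · simpa using hxp.symm
          · rw [hD _ hk]; exact hB.notMem _ hk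
        · intro k hk y hy z hz hzk hyz
          rw [Finset.mem_insert] at hk
          rcases hk with rfl | hk
          · simp only [Function.update_self, Finset.mem_singleton] at hy hzk
            subst hy
            refine ⟨rfl, hadj z ?_ hyz⟩
            simpa [hzk] using hz
          · rw [hD _ hk] at hy hzk
            by_cases hzx : z = x
            · subst hzx
              have := hadj y (by
                simp only [Finset.mem_insert, Finset.mem_biUnion]; exact Or.inr ⟨k, hk, hy⟩) hyz.symm
              subst this
              exact absurd hy (hB.notMem _ hk)
            · exact hB.out k hk y hy z (by simpa [hzx] using hz) hzk hyz
      · intro k hk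
        rw [Finset.mem_insert] at hk
        rcases hk with rfl | hk
        · simpa using RTree.singleton k
        · rw [hD _ hk]; exact hK _ hk
    · obtain ⟨k0, hk0, hpk⟩ : ∃ k ∈ K, p ∈ D k := by simpa [hpr] using hp
      have hxD : ∀ k ∈ K, x ∉ D k := fun k hk hxk => hx (by
        simp only [Finset.mem_insert, Finset.mem_biUnion]; exact Or.inr ⟨k, hk, hxk⟩)
      have hDS : ∀ k ∈ K, ∀ z ∈ D k, z ∈ insert r (K.biUnion D) := fun k hk z hz => by
        simp only [Finset.mem_insert, Finset.mem_biUnion]; exact Or.inr ⟨k, hk, hz⟩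
      have hxr : x ≠ r := by rintro rfl; simp at hx
      set D' : V → Finset V := Function.update D k0 (insert x (D k0)) with hD'
      have hself : D' k0 = insert x (D k0) := Function.update_self _ _ _
      have hne : ∀ k, k ≠ k0 → D' k = D k := fun k hk => Function.update_of_ne hk _ _
      have hU : K.biUnion D' = insert x (K.biUnion D) := by
        ext z
        simp only [Finset.mem_insert, Finset.mem_biUnion]
        constructor
        · rintro ⟨k, hk, hz⟩
          by_cases h : k = k0
          · subst h
            rw [hself, Finset.mem_insert] at hz
            exact hz.imp id fun hz => ⟨k, hk, hz⟩
          · rw [hne _ h] at hz; exact Or.inr ⟨k, hk, hz⟩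
        · rintro (rfl | ⟨k, hk, hz⟩)
          · exact ⟨k0, hk0, by simp [hself]⟩
          · by_cases h : k = k0
            · subst h; exact ⟨k, hk, by simp [hself, hz]⟩
            · exact ⟨k, hk, by rwa [hne _ h]⟩
      have := RTree.node (G := G) r K D' ?_ ?_
      · rwa [hU, Finset.insert_comm] at this
      · rw [hU]
        constructor
        · intro k hk k' hk' hkk
          have h0 := hB.disj k hk k' hk' hkk
          by_cases h : k = k0
          · subst h
            rw [hself, hne _ hkk.symm, Finset.disjoint_insert_left]
            exact ⟨hxD _ hk', h0⟩
          · by_cases h' : k' = k0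
            · subst h'
              rw [hself, hne _ h, Finset.disjoint_insert_right]
              exact ⟨hxD _ hk, h0⟩
            · rwa [hne _ h, hne _ h']
        · intro k hk
          by_cases h : k = k0
          · subst h; simp [hself, hB.mem _ hk]
          · rw [hne _ h]; exact hB.mem _ hk
        · intro k hk
          by_cases h : k = k0
          · subst h; simp [hself, hB.notMem _ hk, hxr.symm]
          · rw [hne _ h]; exact hB.notMem _ hk
        · intro k hk y hy z hz hzk hyz
          have hz' : z ≠ x → z ∈ insert r (K.biUnion D) := fun h => by simpa [h] using hz
          by_cases h : k = k0
          · subst h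
            simp only [hself, Finset.mem_insert, not_or] at hy hzk
            rcases hy with rfl | hy
            · have := hadj z (hz' hzk.1) hyz
              subst this
              exact absurd hpk hzk.2
            · exact hB.out k hk y hy z (hz' hzk.1) hzk.2 hyz
          · rw [hne _ h] at hy hzk
            by_cases hzx : z = x
            · subst hzx
              have := hadj y (hDS k hk y hy) hyz.symm
              subst this
              exact absurd hpk (Finset.disjoint_left.1 (hB.disj k hk k0 hk0 h) hy)
            · exact hB.out k hk y hy z (hz' hzx) hzk hyz
      · intro k hk
        by_cases h : k = k0
        · subst h
          rw [hself]
          exact ih k hk hpk (hxD _ hk) fun z hz => hadj z (hDS k hk z hz)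
        · rw [hne _ h]; exact hK _ hk

/-- Every nonempty set of vertices contains one with at most one neighbour in the set. -/
def LeafyGraph (G : SimpleGraph V) : Prop :=
  ∀ S : Finset V, S.Nonempty → ∃ x ∈ S, ∀ y ∈ S, ∀ z ∈ S, G.Adj x y → G.Adj x z → y = z

theorem LeafyGraph.rTree (hG : LeafyGraph G) {r : V} {S : Finset V} (hr : r ∈ S) :
    RTree G r S := by
  induction hn : S.card generalizing S r with
  | zero => rw [Finset.card_eq_zero] at hn; subst hn; simp at hr
  | succ n ih =>
    obtain ⟨x, hx, hleaf⟩ := hG S ⟨r, hr⟩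
    have hcard : (S.erase x).card = n := by rw [Finset.card_erase_of_mem hx]; omega
    have hnb : ∀ q ∈ S.erase x, ∃ p ∈ S.erase x, ∀ z ∈ S.erase x, G.Adj x z → z = p := by
      intro q hq
      by_cases h : ∃ p ∈ S.erase x, G.Adj x p
      · obtain ⟨p, hp, hxp⟩ := h
        exact ⟨p, hp, fun z hz hxz =>
          hleaf z (Finset.mem_of_mem_erase hz) p (Finset.mem_of_mem_erase hp) hxz hxp⟩
      · exact ⟨q, hq, fun z hz hxz => absurd ⟨z, hz, hxz⟩ h⟩
    by_cases hxr : r = x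
    · subst hxr
      rcases (S.erase r).eq_empty_or_nonempty with he | ⟨q, hq⟩
      · have : S = {r} := by rw [← Finset.insert_erase hr, he]; rfl
        rw [this]; exact RTree.singleton r
      · obtain ⟨p, hp, hadj⟩ := hnb q hq
        have hU : insert r (({p} : Finset V).biUnion fun _ => S.erase r) = S := by
          rw [Finset.singleton_biUnion, Finset.insert_erase hr]
        rw [← hU]
        refine RTree.node r {p} (fun _ => S.erase r) ?_ fun k hk => ?_
        · rw [hU]
          constructor
          · intro k hk k' hk' hne
            rw [Finset.mem_singleton] at hk hk'
            exact absurd (hk.trans hk'.symm) hne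
          · intro k hk; rw [Finset.mem_singleton] at hk; rwa [hk]
          · simp
          · intro k hk y hy z hz hzk hyz
            rw [Finset.mem_singleton] at hk
            subst hk
            have hzr : z = r := by
              by_contra h; exact hzk (Finset.mem_erase.2 ⟨h, hz⟩)
            subst hzr
            exact ⟨hadj y hy hyz.symm, rfl⟩
        · rw [Finset.mem_singleton] at hk
          subst hk
          exact ih hp hcard
    · have hre : r ∈ S.erase x := Finset.mem_erase.2 ⟨hxr, hr⟩
      obtain ⟨p, hp, hadj⟩ := hnb r hre
      have := (ih hre hcard).insert_leaf hp (Finset.notMem_erase x S) hadj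
      rwa [Finset.insert_erase hx] at this

/-- A rooted tree with at least `t` vertices contains a subtree with at least `t` vertices all of
whose branches have fewer than `t` vertices. -/
theorem RTree.locate {r : V} {S : Finset V} (h : RTree G r S) {t : ℕ} (ht : t ≤ S.card) :
    ∃ y K, ∃ D : V → Finset V, insert y (K.biUnion D) ⊆ S ∧
      t ≤ (insert y (K.biUnion D)).card ∧ Branching G y K D S ∧
      (∀ k ∈ K, RTree G k (D k) ∧ (D k).card < t) ∧
      ((y = r ∧ insert y (K.biUnion D) = S) ∨
        (r ∉ insert y (K.biUnion D) ∧ ∃ s ∈ S, s ∉ insert y (K.biUnion D) ∧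
          ∀ x ∈ insert y (K.biUnion D), ∀ z ∈ S, z ∉ insert y (K.biUnion D) →
            G.Adj x z → x = y ∧ z = s)) := by
  induction h with
  | node r K D hB hK ih =>
    by_cases hk : ∃ k ∈ K, t ≤ (D k).card
    · obtain ⟨k, hk, htk⟩ := hk
      obtain ⟨y, K', D', hY, hYt, hB', hK', hroot⟩ := ih k hk htk
      have hDS : D k ⊆ insert r (K.biUnion D) :=
        (Finset.subset_biUnion_of_mem D hk).trans (Finset.subset_insert _ _)
      have hsub : ∀ k' ∈ K', ∀ x ∈ D' k', x ∈ insert y (K'.biUnion D') := fun k' hk' x hx => by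
        simp only [Finset.mem_insert, Finset.mem_biUnion]; exact Or.inr ⟨k', hk', hx⟩
      generalize hYe : insert y (K'.biUnion D') = Y at *
      refine ⟨y, K', D', hYe ▸ hY.trans hDS, hYe ▸ hYt, ⟨hB'.disj, hB'.mem, hB'.notMem, ?_⟩, hK', ?_⟩
      · intro k' hk' x hx z hz hzk hxz
        by_cases hzD : z ∈ D k
        · exact hB'.out k' hk' x hx z hzD hzk hxz
        · obtain ⟨rfl, rfl⟩ := hB.out k hk x (hY (hsub k' hk' x hx)) z hz hzD hxz
          rcases hroot with ⟨rfl, -⟩ | ⟨h1, -⟩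
          · exact absurd hx (hB'.notMem _ hk')
          · exact absurd (hsub k' hk' x hx) h1
      · rw [hYe]
        right
        refine ⟨fun hr => hB.notMem k hk (hY hr), ?_⟩
        rcases hroot with ⟨rfl, rfl⟩ | ⟨h1, s, hs, hsY, hs'⟩
        · refine ⟨r, Finset.mem_insert_self _ _, hB.notMem _ hk, ?_⟩
          exact fun x hx z hz hzY hxz => hB.out _ hk x hx z hz hzY hxz
        · refine ⟨s, hDS hs, hsY, fun x hx z hz hzY hxz => ?_⟩
          by_cases hzD : z ∈ D k
          · exact hs' x hx z hzD hzY hxz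
          · obtain ⟨rfl, rfl⟩ := hB.out k hk x (hY hx) z hz hzD hxz
            exact absurd hx h1
    · push Not at hk
      exact ⟨r, K, D, subset_rfl, ht, hB, fun k hkK => ⟨hK k hkK, hk k hkK⟩, Or.inl ⟨rfl, rfl⟩⟩

theorem exists_minimal_sum {K : Finset V} (f : V → ℕ) {t : ℕ} (ht : t ≤ ∑ k ∈ K, f k) :
    ∃ K' ⊆ K, t ≤ ∑ k ∈ K', f k ∧ ∀ k ∈ K', ∑ k ∈ K', f k < t + f k := by
  obtain ⟨K', hK', hmin⟩ := Finset.exists_min_image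
    (K.powerset.filter fun A => t ≤ ∑ k ∈ A, f k) Finset.card ⟨K, by simpa using ht⟩
  simp only [Finset.mem_filter, Finset.mem_powerset] at hK' hmin
  refine ⟨K', hK'.1, hK'.2, fun k hk => ?_⟩
  by_contra hc
  have h1 := Finset.add_sum_erase K' f hk
  have h2 := hmin (K'.erase k) ⟨(Finset.erase_subset _ _).trans hK'.1, by omega⟩
  have := Finset.card_erase_lt_of_mem hk
  omega

/-- A minimal union of branches with at least `t` vertices. -/
theorem Branching.exists_minimal {y : V} {K : Finset V} {D : V → Finset V} {S : Finset V}
    (hB : Branching G y K D S) {t : ℕ} (ht : t < (insert y (K.biUnion D)).card) :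
    ∃ K' ⊆ K, t ≤ (K'.biUnion D).card ∧ ∀ k ∈ K', (K'.biUnion D).card < t + (D k).card := by
  have hcard : ∀ A ⊆ K, (A.biUnion D).card = ∑ k ∈ A, (D k).card := fun A hA =>
    Finset.card_biUnion fun k hk k' hk' hne => hB.disj k (hA hk) k' (hA hk') hne
  have := Finset.card_insert_le y (K.biUnion D)
  obtain ⟨K', h1, h2, h3⟩ := exists_minimal_sum (K := K) (fun k => (D k).card) (t := t)
    (by rw [← hcard K subset_rfl]; omega)
  rw [← hcard K' h1] at h2 h3
  exact ⟨K', h1, h2, h3⟩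

/-- A vertex `w` together with a union `F` of branches at `w` of suitable size. -/
def HasHit (G : SimpleGraph V) (S : Finset V) (r : V) (b L : ℕ) : Prop :=
  ∃ w ∈ S, ∃ F ⊆ S, w ∉ F ∧ r ∉ F ∧ b ≤ F.card ∧ F.card ≤ b + L ∧
    ∀ x ∈ F, ∀ y ∈ S, y ∉ F → G.Adj x y → y = w

/-- A partition of `S` obtained by deleting the two vertices `z` and `o`. -/
structure TwoVertexSplit (G : SimpleGraph V) (S : Finset V) (r : V) (b L : ℕ) where
  z : V
  o : V
  c : V
  K : Finset V
  D : V → Finset V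
  A : Finset V
  X : Finset V
  q : ℕ
  m : ℕ
  z_mem : z ∈ S
  o_mem : o ∈ S
  z_ne_o : z ≠ o
  U_sub : K.biUnion D ⊆ S
  A_sub : A ⊆ S
  X_sub : X ⊆ S
  z_notMem : z ∉ K.biUnion D ∪ A ∪ X
  o_notMem : o ∉ K.biUnion D ∪ A ∪ X
  r_notMem : r ∉ K.biUnion D ∪ A ∪ X
  disj_UA : Disjoint (K.biUnion D) A
  disj_UX : Disjoint (K.biUnion D) X
  disj_AX : Disjoint A X
  disj_D : ∀ k ∈ K, ∀ k' ∈ K, k ≠ k' → Disjoint (D k) (D k')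
  q_pos : 1 ≤ q
  m_lt : m + 1 ≤ L
  card_D : ∀ k ∈ K, L + 1 ≤ (D k).card
  card_UA : (K.biUnion D).card + A.card = b + m
  card_X : X.card + m + 1 = L + q
  card_U : (K.biUnion D).card + 1 ≤ b
  q_le : q + L + 2 ≤ b
  out_D : ∀ k ∈ K, ∀ x ∈ D k, ∀ y ∈ S, y ∉ D k → G.Adj x y → y = z ∨ (y = o ∧ x = k)
  out_A : ∀ x ∈ A, ∀ y ∈ S, y ∉ A → G.Adj x y → y = z ∨ (y = o ∧ x = c)
  out_X : ∀ x ∈ X, ∀ y ∈ S, y ∉ X → G.Adj x y → y = z ∨ y = o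

end RootedForest

section Splitting

variable {V : Type*} [DecidableEq V] {G : SimpleGraph V}

/-- A vertex `w` with large branches `D k`, `k ∈ K`, and one further branch `C`. -/
structure BranchPair (G : SimpleGraph V) (S : Finset V) (r w c : V) (K : Finset V)
    (D : V → Finset V) (C : Finset V) (b L q : ℕ) : Prop where
  w_mem : w ∈ S
  U_sub : K.biUnion D ⊆ S
  C_sub : C ⊆ S
  w_notMem_U : w ∉ K.biUnion D
  w_notMem_C : w ∉ C
  r_notMem_U : r ∉ K.biUnion D
  r_notMem_C : r ∉ C
  disj_UC : Disjoint (K.biUnion D) C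
  disj_D : ∀ k ∈ K, ∀ k' ∈ K, k ≠ k' → Disjoint (D k) (D k')
  card_D : ∀ k ∈ K, L + 1 ≤ (D k).card
  out_D : ∀ k ∈ K, ∀ x ∈ D k, ∀ y ∈ S, y ∉ D k → G.Adj x y → x = k ∧ y = w
  out_C : ∀ x ∈ C, ∀ y ∈ S, y ∉ C → G.Adj x y → x = c ∧ y = w
  q_pos : 1 ≤ q
  card_U : (K.biUnion D).card + 1 ≤ b
  q_le : q + L + 2 ≤ b
  card_C : (K.biUnion D).card + C.card = b + L + q

variable {S : Finset V} {r w c : V} {K : Finset V} {D : V → Finset V} {C : Finset V} {b L q : ℕ}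

theorem BranchPair.split_of_edge (h : BranchPair G S r w c K D C b L q) {Y : Finset V} {y s : V}
    {m : ℕ} (hYC : Y ⊆ C) (hy : y ∈ Y)
    (hout : ∀ x ∈ Y, ∀ z ∈ C, z ∉ Y → G.Adj x z → x = y ∧ z = s)
    (hm : m + 1 ≤ L) (hYm : Y.card + m = L + q) : Nonempty (TwoVertexSplit G S r b L) := by
  have hd := Finset.disjoint_left.1 h.disj_UC
  have h1 := h.w_notMem_U
  have h2 := h.w_notMem_C
  have h3 := h.r_notMem_U
  have h4 := h.r_notMem_C
  have hyC := hYC hy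
  have hYc : ∀ x ∈ Y, x ∈ C := fun x hx => hYC hx
  refine ⟨{
    z := w
    o := y
    c := s
    K := K
    D := D
    A := C \ Y
    X := Y.erase y
    q := q
    m := m
    z_mem := h.w_mem
    o_mem := h.C_sub hyC
    z_ne_o := fun e => h2 (e ▸ hyC)
    U_sub := h.U_sub
    A_sub := Finset.sdiff_subset.trans h.C_sub
    X_sub := (Finset.erase_subset _ _).trans (hYC.trans h.C_sub)
    z_notMem := by grind
    o_notMem := by grind
    r_notMem := by grind
    disj_UA := h.disj_UC.mono_right Finset.sdiff_subset
    disj_UX := h.disj_UC.mono_right ((Finset.erase_subset _ _).trans hYC)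
    disj_AX := Finset.sdiff_disjoint.mono_right (Finset.erase_subset _ _)
    disj_D := h.disj_D
    q_pos := h.q_pos
    m_lt := hm
    card_D := h.card_D
    card_UA := ?_
    card_X := ?_
    card_U := h.card_U
    q_le := h.q_le
    out_D := fun k hk x hx y' hy' hyD hxy => Or.inl (h.out_D k hk x hx y' hy' hyD hxy).2
    out_A := ?_
    out_X := ?_ }⟩
  · have := Finset.card_sdiff_add_card_eq_card hYC
    have := h.card_C
    omega
  · have := Finset.card_erase_add_one hy
    omega
  · intro x hx y' hy' hyA hxy
    rw [Finset.mem_sdiff] at hx hyA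
    by_cases hC : y' ∈ C
    · have := hout y' (by tauto) x hx.1 hx.2 hxy.symm
      exact Or.inr this
    · exact Or.inl (h.out_C x hx.1 y' hy' hC hxy).2
  · intro x hx y' hy' hyX hxy
    rw [Finset.mem_erase] at hx hyX
    by_cases hC : y' ∈ C
    · right
      by_contra hne
      exact hx.1 (hout x hx.2 y' hC (by tauto) hxy).1
    · exact Or.inl (h.out_C x (hYC hx.2) y' hy' hC hxy).2

theorem BranchPair.split_of_star (h : BranchPair G S r w c K D C b L q) {A : Finset V} {y : V}
    {m : ℕ} (hAC : A ⊆ C) (hyC : y ∈ C) (hyA : y ∉ A)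
    (hout : ∀ x ∈ A, ∀ z ∈ C, z ∉ A → G.Adj x z → z = y)
    (hm : m + 1 ≤ L) (hAm : (K.biUnion D).card + A.card = b + m) :
    Nonempty (TwoVertexSplit G S r b L) := by
  have hd := Finset.disjoint_left.1 h.disj_UC
  have h1 := h.w_notMem_U
  have h2 := h.w_notMem_C
  have h3 := h.r_notMem_U
  have h4 := h.r_notMem_C
  have hAc : ∀ x ∈ A, x ∈ C := fun x hx => hAC hx
  refine ⟨{
    z := y
    o := w
    c := c
    K := K
    D := D
    A := A
    X := (C \ A).erase y
    q := q
    m := m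
    z_mem := h.C_sub hyC
    o_mem := h.w_mem
    z_ne_o := fun e => h2 (e ▸ hyC)
    U_sub := h.U_sub
    A_sub := hAC.trans h.C_sub
    X_sub := (Finset.erase_subset _ _).trans (Finset.sdiff_subset.trans h.C_sub)
    z_notMem := by grind
    o_notMem := by grind
    r_notMem := by grind
    disj_UA := h.disj_UC.mono_right hAC
    disj_UX := h.disj_UC.mono_right ((Finset.erase_subset _ _).trans Finset.sdiff_subset)
    disj_AX := Finset.disjoint_sdiff.mono_right (Finset.erase_subset _ _)
    disj_D := h.disj_D
    q_pos := h.q_pos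
    m_lt := hm
    card_D := h.card_D
    card_UA := hAm
    card_X := ?_
    card_U := h.card_U
    q_le := h.q_le
    out_D := fun k hk x hx y' hy' hyD hxy => Or.inr (h.out_D k hk x hx y' hy' hyD hxy).symm
    out_A := ?_
    out_X := ?_ }⟩
  · have h5 := Finset.card_sdiff_add_card_eq_card hAC
    have h6 := Finset.card_erase_add_one (Finset.mem_sdiff.2 ⟨hyC, hyA⟩)
    have := h.card_C
    omega
  · intro x hx y' hy' hyA hxy
    by_cases hC : y' ∈ C
    · exact Or.inl (hout x hx y' hC hyA hxy)
    · exact Or.inr (h.out_C x (hAC hx) y' hy' hC hxy).symm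
  · intro x hx y' hy' hyX hxy
    rw [Finset.mem_erase, Finset.mem_sdiff] at hx hyX
    by_cases hC : y' ∈ C
    · left
      by_contra hne
      exact hx.1 (hout y' (by tauto) x hx.2.1 hx.2.2 hxy.symm)
    · exact Or.inr (h.out_C x hx.2.1 y' hy' hC hxy).2

theorem BranchPair.split (h : BranchPair G S r w c K D C b L q) (hC : RTree G c C) (hL : 1 ≤ L)
    (hq : q ≤ L ∨ b ≤ (K.biUnion D).card + L + 1) : Nonempty (TwoVertexSplit G S r b L) := by
  obtain ⟨x, hx⟩ : ∃ x, x + (K.biUnion D).card = b := ⟨b - (K.biUnion D).card, by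
    have := h.card_U; omega⟩
  have hU := h.card_U
  have hCc := h.card_C
  have hq1 := h.q_pos
  -- the minimal families of branches of the vertex found by `locate`
  have key : ∀ (y : V) (K' : Finset V) (D' : V → Finset V), Branching G y K' D' C →
      insert y (K'.biUnion D') ⊆ C → ∀ K1 ⊆ K', y ∉ K1.biUnion D' ∧
        K1.biUnion D' ⊆ K'.biUnion D' ∧
        ∀ a ∈ K1.biUnion D', ∀ z ∈ C, z ∉ K1.biUnion D' → G.Adj a z → z = y := by
    intro y K' D' hB hsub K1 hK1
    refine ⟨?_, Finset.biUnion_subset_biUnion_of_subset_left _ hK1, ?_⟩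
    · rw [Finset.mem_biUnion]
      rintro ⟨k, hk, hyk⟩
      exact hB.notMem k (hK1 hk) hyk
    · intro a ha z hz hzK haz
      rw [Finset.mem_biUnion] at ha hzK
      obtain ⟨k, hk, hak⟩ := ha
      exact (hB.out k (hK1 hk) a hak z hz (fun hzk => hzK ⟨k, hk, hzk⟩) haz).2
  by_cases hqL : q ≤ L
  · obtain ⟨y, K', D', hYC, hYt, hB, hK', hroot⟩ := hC.locate (t := q + 1) (by omega)
    have hk := key y K' D' hB hYC
    by_cases hYs : (insert y (K'.biUnion D')).card ≤ q + L
    · rcases hroot with ⟨-, h2⟩ | ⟨-, s, hs, hsY, hout⟩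
      · rw [h2] at hYs; omega
      · exact h.split_of_edge (m := L + q - (insert y (K'.biUnion D')).card) hYC
          (Finset.mem_insert_self _ _) hout (by omega) (by omega)
    · obtain ⟨K1, hK1, hlo, hhi⟩ := hB.exists_minimal
        (t := (insert y (K'.biUnion D')).card - L - q) (by omega)
      obtain ⟨h1, h2, h3⟩ := hk K1 hK1
      have hne : (K1.biUnion D').Nonempty := by rw [← Finset.card_pos]; omega
      obtain ⟨a, ha⟩ := hne
      obtain ⟨k, hkK, -⟩ := Finset.mem_biUnion.1 ha
      have h4 := hhi k hkK
      have h5 := (hK' k (hK1 hkK)).2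
      have h6 : K1.biUnion D' ⊆ insert y (K'.biUnion D') := h2.trans (Finset.subset_insert _ _)
      have h7 := Finset.card_sdiff_add_card_eq_card h6
      have h8 : insert y (K'.biUnion D') \ K1.biUnion D' ⊆ C := Finset.sdiff_subset.trans hYC
      have h9 := Finset.card_sdiff_add_card_eq_card h8
      refine h.split_of_star (A := C \ (insert y (K'.biUnion D') \ K1.biUnion D')) (y := y)
        (m := (K1.biUnion D').card - ((insert y (K'.biUnion D')).card - L - q))
        Finset.sdiff_subset (hYC (Finset.mem_insert_self _ _)) ?_ ?_ (by omega) (by omega)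
      · simp [h1]
      · intro x hx z hz hzA hxz
        simp only [Finset.mem_sdiff, not_and, not_not] at hx
        obtain ⟨hzY, hzK⟩ : z ∈ insert y (K'.biUnion D') ∧ z ∉ K1.biUnion D' := by
          rw [Finset.mem_sdiff, Finset.mem_sdiff] at hzA
          tauto
        by_cases hxK : x ∈ K1.biUnion D'
        · exact h3 x hxK z hz hzK hxz
        · have hxY : x ∉ insert y (K'.biUnion D') := fun hxY => hxK (hx.2 hxY)
          by_contra hzy
          have hz' : z ∈ K'.biUnion D' := by simpa [hzy] using hzY
          have := (hk K' subset_rfl).2.2 z hz' x hx.1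
            (fun h => hxY (Finset.mem_insert_of_mem h)) hxz.symm
          exact hxY (this ▸ Finset.mem_insert_self _ _)
  · have hxL : x ≤ L + 1 := by omega
    obtain ⟨y, K', D', hYC, hYt, hB, hK', hroot⟩ := hC.locate (t := x) (by omega)
    have hk := key y K' D' hB hYC
    by_cases hYs : (insert y (K'.biUnion D')).card + 1 ≤ x + L
    · rcases hroot with ⟨-, h2⟩ | ⟨-, s, hs, hsY, hout⟩
      · rw [h2] at hYs; omega
      · have h5 := Finset.card_sdiff_add_card_eq_card hYC
        refine h.split_of_edge (Y := C \ insert y (K'.biUnion D')) (y := s) (s := y)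
          (m := (insert y (K'.biUnion D')).card - x) Finset.sdiff_subset
          (Finset.mem_sdiff.2 ⟨hs, hsY⟩) ?_ (by omega) (by omega)
        intro a ha z hz hza haz
        rw [Finset.mem_sdiff] at ha hza
        exact (hout z (by tauto) a ha.1 ha.2 haz.symm).symm
    · obtain ⟨K1, hK1, hlo, hhi⟩ := hB.exists_minimal (t := x) (by omega)
      obtain ⟨h1, h2, h3⟩ := hk K1 hK1
      have hne : (K1.biUnion D').Nonempty := by rw [← Finset.card_pos]; omega
      obtain ⟨a, ha⟩ := hne
      obtain ⟨k, hkK, -⟩ := Finset.mem_biUnion.1 ha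
      have h4 := hhi k hkK
      have h5 := (hK' k (hK1 hkK)).2
      exact h.split_of_star (A := K1.biUnion D') (y := y) (m := (K1.biUnion D').card - x)
        (h2.trans ((Finset.subset_insert _ _).trans hYC)) (hYC (Finset.mem_insert_self _ _)) h1 h3
        (by omega) (by omega)

theorem hasHit_or_split (hS : RTree G r S) (hL : 1 ≤ L) (hb : b ≤ 4 * L + 3)
    (hbS : b + 1 ≤ S.card) : HasHit G S r b L ∨ Nonempty (TwoVertexSplit G S r b L) := by
  obtain ⟨w, K, D, hYS, hYt, hB, hK, hroot⟩ := hS.locate hbS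
  obtain ⟨K0, hK0, hlo, hhi⟩ := hB.exists_minimal (t := b) (by omega)
  have hFY : K0.biUnion D ⊆ insert w (K.biUnion D) :=
    (Finset.biUnion_subset_biUnion_of_subset_left _ hK0).trans (Finset.subset_insert _ _)
  have hwF : w ∉ K0.biUnion D := by
    rw [Finset.mem_biUnion]
    rintro ⟨k, hk, hwk⟩
    exact hB.notMem k (hK0 hk) hwk
  have hrF : r ∉ K0.biUnion D := by
    rcases hroot with ⟨rfl, -⟩ | ⟨hr, -⟩
    · exact hwF
    · exact fun h => hr (hFY h)
  have hwS : w ∈ S := hYS (Finset.mem_insert_self _ _)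
  by_cases hF : (K0.biUnion D).card ≤ b + L
  · left
    refine ⟨w, hwS, K0.biUnion D, hFY.trans hYS, hwF, hrF, hlo, hF, ?_⟩
    intro x hx y hy hyF hxy
    rw [Finset.mem_biUnion] at hx hyF
    obtain ⟨k, hk, hxk⟩ := hx
    exact (hB.out k (hK0 hk) x hxk y hy (fun hyk => hyF ⟨k, hk, hyk⟩) hxy).2
  right
  obtain ⟨a, ha⟩ : (K0.biUnion D).Nonempty := by rw [← Finset.card_pos]; omega
  obtain ⟨k0, hk0, -⟩ := Finset.mem_biUnion.1 ha
  obtain ⟨c, hc, hmin⟩ := Finset.exists_min_image K0 (fun k => (D k).card) ⟨k0, hk0⟩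
  have hins : K0.biUnion D = D c ∪ (K0.erase c).biUnion D := by
    rw [← Finset.biUnion_insert, Finset.insert_erase hc]
  have hdisj : Disjoint ((K0.erase c).biUnion D) (D c) := by
    rw [Finset.disjoint_biUnion_left]
    intro k hk
    rw [Finset.mem_erase] at hk
    exact hB.disj k (hK0 hk.2) c (hK0 hc) hk.1
  have hcard : ((K0.erase c).biUnion D).card + (D c).card = (K0.biUnion D).card := by
    rw [hins, Finset.union_comm, Finset.card_union_of_disjoint hdisj]
  have hUF : (K0.erase c).biUnion D ⊆ K0.biUnion D := hins ▸ Finset.subset_union_right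
  have hCF : D c ⊆ K0.biUnion D := hins ▸ Finset.subset_union_left
  have hc1 := hhi c hc
  have hc2 := (hK c (hK0 hc)).2
  have hge : (D c).card ≤ ((K0.erase c).biUnion D).card := by
    obtain ⟨a, ha⟩ : ((K0.erase c).biUnion D).Nonempty := by rw [← Finset.card_pos]; omega
    obtain ⟨k, hk, -⟩ := Finset.mem_biUnion.1 ha
    exact (hmin k (Finset.mem_of_mem_erase hk)).trans
      (Finset.card_le_card (Finset.subset_biUnion_of_mem D hk))
  have hpair : BranchPair G S r w c (K0.erase c) D (D c) b L ((K0.biUnion D).card - b - L) :=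
    { w_mem := hwS
      U_sub := hUF.trans (hFY.trans hYS)
      C_sub := hCF.trans (hFY.trans hYS)
      w_notMem_U := fun h => hwF (hUF h)
      w_notMem_C := fun h => hwF (hCF h)
      r_notMem_U := fun h => hrF (hUF h)
      r_notMem_C := fun h => hrF (hCF h)
      disj_UC := hdisj
      disj_D := fun k hk k' hk' =>
        hB.disj k (hK0 (Finset.mem_of_mem_erase hk)) k' (hK0 (Finset.mem_of_mem_erase hk'))
      card_D := fun k hk => by
        have := hhi k (Finset.mem_of_mem_erase hk); omega
      out_D := fun k hk => hB.out k (hK0 (Finset.mem_of_mem_erase hk))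
      out_C := hB.out c (hK0 hc)
      q_pos := by omega
      card_U := by omega
      q_le := by omega
      card_C := by omega }
  exact hpair.split (hK c (hK0 hc)).1 hL (by omega)

end Splitting

section Embedding

variable {V W : Type*} {G : SimpleGraph V} {H : SimpleGraph W}

/-- `f` embeds the subgraph of `G` induced on `S` into `H`, with image inside `B`. -/
structure IsEmb (G : SimpleGraph V) (H : SimpleGraph W) (S : Finset V) (B : Finset W)
    (f : V → W) : Prop where
  inj : ∀ x ∈ S, ∀ y ∈ S, f x = f y → x = y
  maps : ∀ x ∈ S, f x ∈ B
  adj : ∀ x ∈ S, ∀ y ∈ S, G.Adj x y → H.Adj (f x) (f y)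

theorem IsEmb.mono {S : Finset V} {B B' : Finset W} {f : V → W} (h : IsEmb G H S B f)
    (hB : B ⊆ B') : IsEmb G H S B' f :=
  ⟨h.inj, fun x hx => hB (h.maps x hx), h.adj⟩

theorem IsEmb.union [DecidableEq V] [DecidableEq W] {S S' : Finset V} {B B' : Finset W} {f f' : V → W} (h : IsEmb G H S B f)
    (h' : IsEmb G H S' B' f') (hS : Disjoint S S') (hB : Disjoint B B')
    (hadj : ∀ x ∈ S, ∀ y ∈ S', G.Adj x y → H.Adj (f x) (f' y)) :
    ∃ g, IsEmb G H (S ∪ S') (B ∪ B') g ∧ (∀ x ∈ S, g x = f x) ∧ ∀ x ∈ S', g x = f' x := by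
  have hg : ∀ x ∈ S, (if x ∈ S then f x else f' x) = f x := fun x hx => if_pos hx
  have hg' : ∀ x ∈ S', (if x ∈ S then f x else f' x) = f' x := fun x hx =>
    if_neg (Finset.disjoint_right.1 hS hx)
  have hne : ∀ x ∈ S, ∀ y ∈ S', f x ≠ f' y := fun x hx y hy e =>
    Finset.disjoint_left.1 hB (h.maps x hx) (e ▸ h'.maps y hy)
  refine ⟨fun x => if x ∈ S then f x else f' x, ⟨?_, ?_, ?_⟩, hg, hg'⟩
  · intro x hx y hy e
    rw [Finset.mem_union] at hx hy
    rcases hx with hx | hx <;> rcases hy with hy | hy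
    · rw [hg x hx, hg y hy] at e; exact h.inj x hx y hy e
    · rw [hg x hx, hg' y hy] at e; exact absurd e (hne x hx y hy)
    · rw [hg' x hx, hg y hy] at e; exact absurd e.symm (hne y hy x hx)
    · rw [hg' x hx, hg' y hy] at e; exact h'.inj x hx y hy e
  · intro x hx
    rw [Finset.mem_union] at hx ⊢
    rcases hx with hx | hx
    · rw [hg x hx]; exact Or.inl (h.maps x hx)
    · rw [hg' x hx]; exact Or.inr (h'.maps x hx)
  · intro x hx y hy e
    rw [Finset.mem_union] at hx hy
    rcases hx with hx | hx <;> rcases hy with hy | hy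
    · rw [hg x hx, hg y hy]; exact h.adj x hx y hy e
    · rw [hg x hx, hg' y hy]; exact hadj x hx y hy e
    · rw [hg' x hx, hg y hy]; exact (hadj y hy x hx e.symm).symm
    · rw [hg' x hx, hg' y hy]; exact h'.adj x hx y hy e

theorem IsEmb.insert [DecidableEq V] [DecidableEq W] {S : Finset V} {B : Finset W} {f : V → W} (h : IsEmb G H S B f) {z : V}
    {u : W} (hz : z ∉ S) (hu : u ∉ B) (hadj : ∀ x ∈ S, G.Adj z x → H.Adj u (f x)) :
    ∃ g, IsEmb G H (insert z S) (insert u B) g ∧ g z = u ∧ ∀ x ∈ S, g x = f x := by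
  have h1 : IsEmb G H {z} {u} (fun _ => u) :=
    ⟨fun x hx y hy _ => by simp at hx hy; rw [hx, hy], by simp,
      fun x hx y hy e => by simp at hx hy; subst hx; subst hy; exact absurd rfl e.ne⟩
  obtain ⟨g, hg, hg1, hg2⟩ := h1.union h (by simpa using hz) (by simpa using hu)
    fun x hx y hy e => by simp at hx; subst hx; exact hadj y hy e
  exact ⟨g, by rwa [Finset.insert_eq, Finset.insert_eq], hg1 z (by simp), hg2⟩

end Embedding

namespace DFSTree

variable {N : ℕ} {T : DFSTree N} {V : Type*} [DecidableEq V] {G : SimpleGraph V}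

/-- The vertex set `S` embeds into every block of the right size below at most one vertex, with
any given vertex of `S` placed on the top level. -/
def Packs (T : DFSTree N) (G : SimpleGraph V) (S : Finset V) : Prop :=
  ∀ l s e, e ≤ N → T.UniqueAbove l s e → (T.block l s e).card = S.card → ∀ r,
    ∃ f, IsEmb G (T.graph 2) S (T.block l s e) f ∧
      (r ∈ S → (∃ x ∈ T.block l s e, T.level x = l) → T.level (f r) = l)

theorem uniqueAbove_succ {l s e u : ℕ}
    (h : ∀ y, s ≤ y → y < e → T.level y = l → y = u) : T.UniqueAbove (l + 1) s e :=
  fun x y h1 h2 h3 h4 h5 h6 =>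
    (h x h1 h2 (by omega)).trans (h y h3 h4 (by omega)).symm

theorem block_eq_insert {l s e u : ℕ} (hsu : s ≤ u) (hue : u < e) (hu : T.level u = l)
    (h : ∀ y, s ≤ y → y < e → T.level y = l → y = u) :
    T.block l s e = insert u (T.block (l + 1) s e) := by
  ext x
  simp only [Finset.mem_insert, mem_block]
  constructor
  · rintro ⟨h1, h2, h3⟩
    by_cases hx : T.level x = l
    · exact Or.inl (h x h1 h2 hx)
    · exact Or.inr ⟨h1, h2, by omega⟩
  · rintro (rfl | ⟨h1, h2, h3⟩)
    · exact ⟨hsu, hue, hu.ge⟩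
    · exact ⟨h1, h2, by omega⟩

theorem card_block_eq_succ {l s e u : ℕ} (hsu : s ≤ u) (hue : u < e) (hu : T.level u = l)
    (h : ∀ y, s ≤ y → y < e → T.level y = l → y = u) :
    (T.block l s e).card = (T.block (l + 1) s e).card + 1 := by
  rw [block_eq_insert hsu hue hu h, Finset.card_insert_of_notMem]
  rw [mem_block]; omega

theorem block_mono {l l' s s' e e' : ℕ} (hl : l' ≤ l) (hs : s' ≤ s) (he : e ≤ e') :
    T.block l s e ⊆ T.block l' s' e' := by
  intro x; simp only [mem_block]; omega

/-- Place `o` on the last vertex of level `l`, a set `X` attached only to `o` below it, and the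
remaining vertices to the left. -/
theorem exists_emb_of_last {S X : Finset V} (ih : ∀ S' : Finset V, S'.card < S.card → T.Packs G S')
    {o r k : V} {l s t u e : ℕ} (he : e ≤ N) (hU : T.UniqueAbove l s e) (hst : s ≤ t) (htu : t ≤ u)
    (hue : u < e) (hul : T.level u = l) (honly : ∀ y, t ≤ y → y < e → T.level y = l → y = u)
    (ho : o ∈ S) (hX : X ⊆ S) (hoX : o ∉ X)
    (hout : ∀ x ∈ X, ∀ y ∈ S, y ∉ X → G.Adj x y → y = o)
    (hXc : (T.block (l + 1) t e).card = X.card) (hSc : (T.block l s e).card = S.card)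
    (hrX : r ∉ X) (hr : r ∈ S → r ≠ o → ∃ x ∈ T.block l s t, T.level x = l) :
    ∃ f, IsEmb G (T.graph 2) S (T.block l s e) f ∧ f o = u ∧ (r ∈ S → T.level (f r) = l) ∧
      (k ∈ X → (∃ x ∈ T.block (l + 1) t e, T.level x = l + 1) → T.level (f k) = l + 1) := by
  have h1 := card_block_eq_succ htu hue hul honly
  have h2 := card_block_add (T := T) (l := l) hst (by omega : t ≤ e)
  have hXS : X ⊆ S.erase o := fun x hx => Finset.mem_erase.2 ⟨fun e => hoX (e ▸ hx), hX hx⟩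
  have h3 := Finset.card_sdiff_add_card_eq_card hXS
  have h4 := Finset.card_erase_add_one ho
  obtain ⟨fX, hfX, hkX⟩ := ih X (by omega) (l + 1) t e he (uniqueAbove_succ honly) hXc k
  obtain ⟨fH, hfH, hrH⟩ := ih (S.erase o \ X) (by omega) l s t (by omega)
    (hU.mono le_rfl (by omega)) (by omega) r
  obtain ⟨g, hg, hgX, hgH⟩ := hfX.union hfH Finset.disjoint_sdiff
    (by rw [Finset.disjoint_left]; intro x; simp only [mem_block]; omega)
    (fun x hx y hy hxy => by
      simp only [Finset.mem_sdiff, Finset.mem_erase] at hy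
      exact absurd (hout x hx y hy.1.2 hy.2 hxy) hy.1.1)
  have hsub : T.block (l + 1) t e ∪ T.block l s t ⊆ T.block l s e :=
    Finset.union_subset (block_mono (by omega) hst le_rfl) (block_mono le_rfl le_rfl (by omega))
  rw [Finset.union_sdiff_of_subset hXS] at hg
  obtain ⟨f, hf, hfo, hfS⟩ := hg.insert (z := o) (u := u) (Finset.notMem_erase _ _)
    (by simp only [Finset.mem_union, mem_block]; omega)
    (fun x hx _ => adj_last he hU hue hul
      (fun y hy hye hyl => by have := honly y (by omega) hye hyl; omega) (hsub (hg.maps x hx))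
      (by
        have := hg.maps x hx
        simp only [Finset.mem_union, mem_block] at this
        rintro rfl; omega))
  rw [Finset.insert_erase ho] at hf
  refine ⟨f, hf.mono (Finset.insert_subset (mem_block.2 ⟨by omega, hue, hul.ge⟩) hsub), hfo, ?_, ?_⟩
  · intro hrS
    by_cases hro : r = o
    · rw [hro, hfo, hul]
    · have hrE : r ∈ S.erase o := Finset.mem_erase.2 ⟨hro, hrS⟩
      have hrE' : r ∈ S.erase o \ X := Finset.mem_sdiff.2 ⟨hrE, hrX⟩
      rw [hfS r hrE, hgH r hrE']
      exact hrH hrE' (hr hrS hro)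
  · intro hk hx
    rw [hfS k (hXS hk), hgX k hk]
    exact hkX hk hx

end DFSTree

namespace DFSTree

variable {N : ℕ} {T : DFSTree N}

/-- The numerical facts about the last two vertices `a < u` of level `l` in `[s, e)`; here `L` is
the number of strict descendants of `a`. -/
structure CousinPair (T : DFSTree N) (l s a u e L : ℕ) : Prop where
  e_le : e ≤ N
  unique : T.UniqueAbove l s e
  s_le : s ≤ a
  a_lt : a < u
  u_lt : u < e
  level_a : T.level a = l
  level_u : T.level u = l
  between : ∀ y, a < y → y < u → T.level y ≠ l
  after : ∀ y, u < y → y < e → T.level y ≠ l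
  L_pos : 1 ≤ L
  card_between : (T.block (l + 1) a u).card = L
  card_after : (T.block (l + 1) u e).card ≤ 4 * L + 3
  exists_level : ∀ t t', t' ≤ N → L + 1 ≤ (T.block (l + 1) t t').card →
    ∃ x ∈ T.block (l + 1) t t', T.level x = l + 1
  prev : ∀ b, s ≤ b → b < a → T.level b = l → (∀ y, b < y → y < a → T.level y ≠ l) →
    (T.block (l + 1) u e).card ≤ L + 1 + (T.block (l + 1) b a).card

theorem descCl_finite (u : ℕ) : (T.descCl u).Finite :=
  (Set.finite_lt_nat N).subset fun _ hx => hx.1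

theorem self_mem_descCl {u : ℕ} (hu : u < N) : u ∈ T.descCl u := ⟨hu, 0, rfl⟩

theorem card_add_one_le_ncard {u : ℕ} (hu : u < N) {B : Finset ℕ}
    (h : ∀ x ∈ B, T.StrictDesc u x) : B.card + 1 ≤ (T.descCl u).ncard := by
  have hn : u ∉ B := fun hB => (h u hB).2 rfl
  rw [← Finset.card_insert_of_notMem hn, ← Set.ncard_coe_finset]
  refine Set.ncard_le_ncard ?_ (descCl_finite u)
  intro x hx
  simp only [Finset.coe_insert, Set.mem_insert_iff, Finset.mem_coe] at hx
  rcases hx with rfl | hx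
  · exact self_mem_descCl hu
  · exact (h x hx).1

theorem ncard_le_card_add_one {a u l : ℕ} (hau : a < u) (ha : T.level a = l)
    (hu : T.level u = l) : (T.descCl a).ncard ≤ (T.block (l + 1) a u).card + 1 := by
  refine le_trans ?_ (Finset.card_insert_le a _)
  rw [← Set.ncard_coe_finset]
  refine Set.ncard_le_ncard ?_ (Finset.finite_toSet _)
  intro x hx
  have hxN := hx.1
  rw [T.mem_descCl_iff hxN] at hx
  rcases hx.1.eq_or_lt with rfl | hlt
  · simp
  · simp only [Finset.coe_insert, Set.mem_insert_iff, Finset.mem_coe, mem_block]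
    right
    have h1 := hx.2 x hlt le_rfl
    refine ⟨hx.1, ?_, by omega⟩
    by_contra hc
    have := hx.2 u hau (by omega)
    omega

theorem strictDesc_of_mem_block {a l e x : ℕ} (he : e ≤ N) (ha : T.level a = l)
    (h : ∀ y, a < y → y < e → T.level y ≠ l) (hx : x ∈ T.block (l + 1) a e) :
    T.StrictDesc a x := by
  rw [mem_block] at hx
  have hax : a ≠ x := by rintro rfl; omega
  exact T.strictDesc_of_forall_ne (by omega) (by omega) ha (by omega) fun z h1 h2 =>
    h z h1 (by omega)

theorem exists_level_of_ncard_le {m L t e : ℕ} (he : e ≤ N)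
    (h : ∀ b, b < N → m ≤ T.level b → (T.descCl b).ncard ≤ L)
    (hc : L ≤ (T.block m t e).card) (hL : 1 ≤ L) : ∃ x ∈ T.block m t e, T.level x = m := by
  by_contra hcon
  push Not at hcon
  obtain ⟨x, hx⟩ : (T.block m t e).Nonempty := by rw [← Finset.card_pos]; omega
  have hx' := mem_block.1 hx
  obtain ⟨b, hb1, hb2, hb3⟩ := T.exists_last_level (x := x) (m := m) (by omega) hx'.2.2
  have hbt : b < t := by
    by_contra hbt
    exact hcon b (mem_block.2 ⟨by omega, by omega, hb2.ge⟩) hb2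
  have := card_add_one_le_ncard (T := T) (u := b) (by omega) (B := T.block m t e) fun y hy => by
    have hy' := mem_block.1 hy
    have hne := hcon y hy
    refine T.strictDesc_of_forall_ne (by omega) (by omega) hb2 (by omega) fun z h1 h2 h3 => ?_
    by_cases hzx : z ≤ x
    · have := hb3 z h1 hzx; omega
    · exact hcon z (mem_block.2 ⟨by omega, by omega, h3.ge⟩) h3
  have := h b (by omega) hb2.ge
  omega

theorem CousinPair.nlc {l s a u e L : ℕ} (h : CousinPair T l s a u e L) : T.Nlc u a :=
  ⟨h.a_lt, by rw [h.level_a, h.level_u], fun c h1 h2 => by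
    rw [h.level_u]; exact h.between c h1 h2⟩

theorem exists_cousinPair (hT : T.IsKSTree 4 1) {l s a u e : ℕ} (he : e ≤ N)
    (hU : T.UniqueAbove l s e) (hsa : s ≤ a) (hau : a < u) (hue : u < e) (ha : T.level a = l)
    (hu : T.level u = l) (hbet : ∀ y, a < y → y < u → T.level y ≠ l)
    (haft : ∀ y, u < y → y < e → T.level y ≠ l) (hB : (T.block (l + 1) u e).Nonempty) :
    ∃ L, CousinPair T l s a u e L := by
  have hn : T.Nlc u a := ⟨hau, by rw [ha, hu], fun c h1 h2 => by rw [hu]; exact hbet c h1 h2⟩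
  have hA := ncard_le_card_add_one hau ha hu
  have hA' := card_add_one_le_ncard (T := T) (u := a) (by omega) (B := T.block (l + 1) a u)
    fun x hx => strictDesc_of_mem_block (by omega) ha hbet hx
  have hB' := card_add_one_le_ncard (T := T) (u := u) (by omega) (B := T.block (l + 1) u e)
    fun x hx => strictDesc_of_mem_block he hu haft hx
  obtain ⟨h1, h2, -, h4⟩ := hT u (by omega)
  obtain ⟨-, -, h3, -⟩ := hT a (by omega)
  have h2 := h2 a hn
  have h3 := h3 ⟨u, hau, by omega, by rw [ha, hu]⟩
  have hpos : 1 ≤ (T.block (l + 1) a u).card := by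
    obtain ⟨x, hx⟩ := hB
    have hd := strictDesc_of_mem_block he hu haft hx
    rw [mem_block] at hx
    rw [T.strictDesc_iff (by omega)] at hd
    have h5 := hd.2 (u + 1) (by omega) (by omega)
    have h6 := T.level_le_pred_succ (j := u + 1) (by omega) (by omega)
    simp only [Nat.add_sub_cancel] at h6
    obtain ⟨c, hc0, hcN, hca⟩ := h4 ⟨u + 1, by omega, by omega,
      T.parent_eq_of_level (by omega) (by omega) (by omega) (by omega)⟩ a hn
    have h7 := card_add_one_le_ncard (T := T) (u := a) (by omega) (B := {c}) fun x hx => by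
      rw [Finset.mem_singleton] at hx
      subst hx
      exact ⟨⟨hcN, 1, hca⟩, by have := T.parent_lt x hc0 hcN; omega⟩
    rw [Finset.card_singleton] at h7
    omega
  refine ⟨(T.block (l + 1) a u).card, he, hU, hsa, hau, hue, ha, hu, hbet, haft, hpos, rfl,
    by omega, ?_, ?_⟩
  · intro t t' ht hc
    exact exists_level_of_ncard_le ht (fun b hb hbl => (h3 b hb (by omega)).trans hA) hc (by omega)
  · intro b hsb hba hb hbb
    have h5 := h1 a b hn ⟨hba, by rw [ha, hb], fun c h1 h2 => by rw [ha]; exact hbb c h1 h2⟩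
    have h6 := ncard_le_card_add_one hba hb ha
    omega

end DFSTree

namespace DFSTree

variable {N : ℕ} {T : DFSTree N} {V : Type*} [DecidableEq V] {G : SimpleGraph V}

theorem exists_last_of_level {y e l : ℕ} (hye : y < e) (hy : T.level y = l) :
    ∃ b, y ≤ b ∧ b < e ∧ T.level b = l ∧ ∀ z, b < z → z < e → T.level z ≠ l := by
  induction e with
  | zero => omega
  | succ e ih =>
    by_cases he : T.level e = l
    · exact ⟨e, by omega, by omega, he, fun z h1 h2 => by omega⟩
    · have hne : y ≠ e := by rintro rfl; exact he hy
      obtain ⟨b, h1, h2, h3, h4⟩ := ih (by omega)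
      refine ⟨b, h1, by omega, h3, fun z hz1 hz2 => ?_⟩
      by_cases hze : z = e
      · rwa [hze]
      · exact h4 z hz1 (by omega)

/-- Large pieces without edges between them can be placed one after another below a vertex, with
their roots on the top level. -/
theorem exists_emb_biUnion {K : Finset V} {D : V → Finset V} {l e L : ℕ} (he : e ≤ N)
    (ih : ∀ k ∈ K, T.Packs G (D k)) (hdisj : ∀ k ∈ K, ∀ k' ∈ K, k ≠ k' → Disjoint (D k) (D k'))
    (hadj : ∀ k ∈ K, ∀ x ∈ D k, ∀ y ∈ K.biUnion D, y ∉ D k → ¬ G.Adj x y)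
    (hcard : ∀ k ∈ K, L + 1 ≤ (D k).card)
    (hlev : ∀ t t', t' ≤ N → L + 1 ≤ (T.block (l + 1) t t').card →
      ∃ x ∈ T.block (l + 1) t t', T.level x = l + 1) {t : ℕ} (hte : t ≤ e)
    (hne : ∀ y, t ≤ y → y < e → T.level y ≠ l)
    (hc : (T.block (l + 1) t e).card = (K.biUnion D).card) :
    ∃ f, IsEmb G (T.graph 2) (K.biUnion D) (T.block (l + 1) t e) f ∧
      ∀ k ∈ K, k ∈ D k → T.level (f k) = l + 1 := by
  induction K using Finset.induction_on generalizing t with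
  | empty => exact ⟨fun _ => 0, ⟨by simp, by simp, by simp⟩, by simp⟩
  | insert k K hk IH =>
    have hdk : Disjoint (D k) (K.biUnion D) := by
      rw [Finset.disjoint_biUnion_right]
      intro k' hk'
      exact hdisj k (by simp) k' (by simp [hk']) (by rintro rfl; exact hk hk')
    rw [Finset.biUnion_insert] at hc ⊢
    rw [Finset.card_union_of_disjoint hdk] at hc
    obtain ⟨t', h1, h2, h3⟩ := exists_card_block_left (T := T) (l := l + 1) (k := (D k).card) hte
      (by omega)
    have h4 := card_block_add (T := T) (l := l + 1) h1 h2
    obtain ⟨g, hg, hgl⟩ := IH (fun k hk => ih k (by simp [hk]))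
      (fun a ha b hb => hdisj a (by simp [ha]) b (by simp [hb]))
      (fun a ha x hx y hy => hadj a (by simp [ha]) x hx y (by
        rw [Finset.biUnion_insert]; exact Finset.mem_union_right _ hy))
      (fun a ha => hcard a (by simp [ha])) h2 (fun y h5 h6 => hne y (by omega) h6) (by omega)
    obtain ⟨f, hf, hfl⟩ := ih k (by simp) (l + 1) t t' (by omega)
      (uniqueAbove_succ (u := 0) fun y h5 h6 h7 => absurd h7 (hne y h5 (by omega))) h3 k
    obtain ⟨F, hF, hF1, hF2⟩ := hf.union hg hdk
      (by rw [Finset.disjoint_left]; intro x; simp only [mem_block]; omega)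
      (fun x hx y hy hxy => absurd hxy (hadj k (by simp) x hx y (by
        rw [Finset.biUnion_insert]; exact Finset.mem_union_right _ hy)
        (Finset.disjoint_right.1 hdk hy)))
    refine ⟨F, hF.mono (Finset.union_subset (block_mono le_rfl le_rfl h2)
      (block_mono le_rfl h1 le_rfl)), fun a ha haD => ?_⟩
    rw [Finset.mem_insert] at ha
    rcases ha with rfl | ha
    · rw [hF1 a haD]
      exact hfl haD (hlev t t' (by omega) (by rw [h3]; exact hcard a (by simp)))
    · rw [hF2 a (Finset.mem_biUnion.2 ⟨a, ha, haD⟩)]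
      exact hgl a ha haD

/-- The part of a split not attached to `o` is placed on a final segment of the block. -/
theorem exists_emb_right {S : Finset V} {r : V} {l s a u e L : ℕ} (h : CousinPair T l s a u e L)
    (ih : ∀ S' : Finset V, S'.card < S.card → T.Packs G S')
    (σ : TwoVertexSplit G S r (T.block (l + 1) u e).card L) {t : ℕ} (hat : a < t) (htu : t ≤ u)
    (ht : (T.block (l + 1) t u).card = σ.m) :
    ∃ f, IsEmb G (T.graph 2) (σ.A ∪ σ.K.biUnion σ.D) (T.block (l + 1) t e) f ∧
      (σ.c ∈ σ.A → T.level (f σ.c) = l + 1) ∧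
      ∀ k ∈ σ.K, k ∈ σ.D k → T.level (f k) = l + 1 := by
  have hue := h.u_lt
  have heN := h.e_le
  have hz : ∀ B : Finset V, B ⊆ S → σ.z ∉ B → B.card < S.card := fun B hB hzB =>
    Finset.card_lt_card (Finset.ssubset_iff_subset_ne.2 ⟨hB, by rintro rfl; exact hzB σ.z_mem⟩)
  have hzn := σ.z_notMem
  have hon := σ.o_notMem
  simp only [Finset.mem_union, not_or] at hzn hon
  have h1 := card_block_add (T := T) (l := l + 1) htu hue.le
  have h2 := σ.card_UA
  have h3 := σ.card_U
  obtain ⟨t', h4, h5, h6⟩ := exists_card_block_left (T := T) (l := l + 1) (s := t) (e := e)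
    (k := σ.A.card) (by omega) (by omega)
  have h7 := card_block_add (T := T) (l := l + 1) h4 h5
  have hut : u < t' := by
    by_contra hc
    have := Finset.card_le_card
      (block_mono (T := T) le_rfl le_rfl (by omega) : T.block (l + 1) t t' ⊆ T.block (l + 1) t u)
    omega
  have honly : ∀ y, t ≤ y → y < t' → T.level y = l → y = u := by
    intro y hy1 hy2 hy3
    rcases lt_trichotomy y u with hlt | heq | hgt
    · exact absurd hy3 (h.between y (by omega) hlt)
    · exact heq
    · exact absurd hy3 (h.after y hgt (by omega))
  obtain ⟨f, hf, hfl⟩ := ih σ.A (hz _ σ.A_sub hzn.1.2) (l + 1) t t' (by omega)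
    (uniqueAbove_succ honly) h6 σ.c
  have hDU : ∀ k ∈ σ.K, σ.D k ⊆ σ.K.biUnion σ.D := fun k hk =>
    Finset.subset_biUnion_of_mem σ.D hk
  obtain ⟨g, hg, hgl⟩ := exists_emb_biUnion (T := T) (G := G) (K := σ.K) (D := σ.D) (l := l)
    (e := e) (L := L) heN
    (fun k hk => ih _ (hz _ ((hDU k hk).trans σ.U_sub) fun hzk => hzn.1.1 (hDU k hk hzk)))
    σ.disj_D
    (fun k hk x hx y hy hyk hxy => by
      rcases σ.out_D k hk x hx y (σ.U_sub hy) hyk hxy with rfl | ⟨rfl, -⟩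
      · exact hzn.1.1 hy
      · exact hon.1.1 hy)
    σ.card_D h.exists_level h5 (fun y hy hye => h.after y (by omega) hye) (by omega)
  obtain ⟨F, hF, hF1, hF2⟩ := hf.union hg σ.disj_UA.symm
    (by rw [Finset.disjoint_left]; intro x; simp only [mem_block]; omega)
    (fun x hx y hy hxy => by
      rcases σ.out_A x hx y (σ.U_sub hy) (Finset.disjoint_left.1 σ.disj_UA hy) hxy with
        rfl | ⟨rfl, -⟩
      · exact absurd hy hzn.1.1
      · exact absurd hy hon.1.1)
  refine ⟨F, hF.mono (Finset.union_subset (block_mono le_rfl le_rfl h5)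
    (block_mono le_rfl h4 le_rfl)), fun hc => ?_, fun k hk hkD => ?_⟩
  · rw [hF1 _ hc]
    refine hfl hc ?_
    have h8 := card_block_add (T := T) (l := l + 1) htu hut.le
    obtain ⟨x, hx⟩ : (T.block (l + 1) u t').Nonempty := by rw [← Finset.card_pos]; omega
    rw [mem_block] at hx
    obtain ⟨z, hz1, hz2, hz3⟩ := T.exists_level_eq (x := u) (y := x) (m := l + 1) hx.1 (by omega)
      (by rw [h.level_u]; omega) hx.2.2
    exact ⟨z, mem_block.2 ⟨by omega, by omega, by omega⟩, hz3⟩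
  · rw [hF2 _ (hDU k hk hkD)]
    exact hgl k hk hkD

/-- The remaining part of a split is placed on an initial segment of the block. -/
theorem exists_emb_left {S : Finset V} {r : V} {l s a u e L : ℕ} (h : CousinPair T l s a u e L)
    (ih : ∀ S' : Finset V, S'.card < S.card → T.Packs G S')
    (σ : TwoVertexSplit G S r (T.block (l + 1) u e).card L) {t : ℕ} (hat : a < t) (htu : t ≤ u)
    (ht : (T.block (l + 1) t u).card = σ.m) (hSc : (T.block l s e).card = S.card) :
    ∃ f, IsEmb G (T.graph 2) (S.erase σ.z \ (σ.A ∪ σ.K.biUnion σ.D)) (T.block l s t) f ∧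
      (f σ.o = a ∨ T.level (f σ.o) = l + 1) ∧
      (r ∈ S.erase σ.z \ (σ.A ∪ σ.K.biUnion σ.D) → T.level (f r) = l) := by
  have hue := h.u_lt
  have heN := h.e_le
  have hsa := h.s_le
  have hau := h.a_lt
  have hzn := σ.z_notMem
  have hon := σ.o_notMem
  have hrn := σ.r_notMem
  simp only [Finset.mem_union, not_or] at hzn hon hrn
  have hE : σ.A ∪ σ.K.biUnion σ.D ⊆ S.erase σ.z := by
    intro x hx
    rw [Finset.mem_union] at hx
    rw [Finset.mem_erase]
    constructor
    · rintro rfl; tauto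
    · exact hx.elim (fun h => σ.A_sub h) fun h => σ.U_sub h
  have hc1 := Finset.card_sdiff_add_card_eq_card hE
  have hc2 := Finset.card_erase_add_one σ.z_mem
  have hc3 := Finset.card_union_of_disjoint σ.disj_UA.symm
  have hc4 := σ.card_UA
  have hc5 := card_block_add (T := T) (l := l + 1) htu hue.le
  have hc6 := card_block_eq_succ (T := T) htu hue h.level_u fun y hy1 hy2 hy3 => by
    rcases lt_trichotomy y u with hlt | heq | hgt
    · exact absurd hy3 (h.between y (by omega) hlt)
    · exact heq
    · exact absurd hy3 (h.after y hgt (by omega))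
  have hc7 := card_block_add (T := T) (l := l) (by omega : s ≤ t) (by omega : t ≤ e)
  have hc8 := card_block_add (T := T) (l := l + 1) hat.le htu
  have hc9 := h.card_between
  have hc10 := σ.card_X
  have hm := σ.m_lt
  have hq := σ.q_pos
  set R := S.erase σ.z \ (σ.A ∪ σ.K.biUnion σ.D) with hR
  have hRS : R ⊆ S := Finset.sdiff_subset.trans (Finset.erase_subset _ _)
  have hRc : R.card < S.card := by omega
  have hXR : σ.X ⊆ R := by
    intro x hx
    have h1 := Finset.disjoint_right.1 σ.disj_UX hx
    have h2 := Finset.disjoint_right.1 σ.disj_AX hx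
    have h3 : x ≠ σ.z := by rintro rfl; tauto
    simp only [hR, Finset.mem_sdiff, Finset.mem_erase, Finset.mem_union]
    exact ⟨⟨h3, σ.X_sub hx⟩, by tauto⟩
  have hoR : σ.o ∈ R := by
    simp only [hR, Finset.mem_sdiff, Finset.mem_erase, Finset.mem_union]
    exact ⟨⟨σ.z_ne_o.symm, σ.o_mem⟩, by tauto⟩
  have hzR : σ.z ∉ R := by simp [hR]
  have ihR : ∀ S' : Finset V, S'.card < R.card → T.Packs G S' := fun S' hS' =>
    ih S' (by omega)
  have honly : ∀ t', (∀ y, t' ≤ y → y < a → T.level y ≠ l) →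
      ∀ y, t' ≤ y → y < t → T.level y = l → y = a := by
    intro t' ht' y hy1 hy2 hy3
    rcases lt_trichotomy y a with hlt | heq | hgt
    · exact absurd hy3 (ht' y hy1 hlt)
    · exact heq
    · exact absurd hy3 (h.between y hgt (by omega))
  by_cases hN : r ∈ R ∧ r ≠ σ.o ∧ ∀ y, s ≤ y → y < a → T.level y ≠ l
  · obtain ⟨hrR, hro, hno⟩ := hN
    have hb := card_block_eq_succ (T := T) hsa hat h.level_a (honly s hno)
    have hre := Finset.card_erase_add_one hrR
    obtain ⟨f, hf, -, hfr, hfo⟩ := exists_emb_of_last (T := T) (G := G) ihR (o := r) (r := r)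
      (k := σ.o) (X := R.erase r) (t := s) (e := t) (u := a) (by omega)
      (h.unique.mono le_rfl (by omega)) le_rfl hsa hat h.level_a (honly s hno) hrR
      (Finset.erase_subset _ _) (Finset.notMem_erase _ _)
      (fun x _ y hy hyX _ => by
        by_contra hne; exact hyX (Finset.mem_erase.2 ⟨hne, hy⟩))
      (by omega) (by omega) (Finset.notMem_erase _ _) (fun _ hne => absurd rfl hne)
    refine ⟨f, hf, Or.inr (hfo (Finset.mem_erase.2 ⟨hro.symm, hoR⟩) ?_), hfr⟩
    obtain ⟨x, hx⟩ : (T.block (l + 1) a t).Nonempty := by rw [← Finset.card_pos]; omega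
    rw [mem_block] at hx
    obtain ⟨z, hz1, hz2, hz3⟩ := T.exists_level_eq (x := a) (y := x) (m := l + 1) hx.1 (by omega)
      (by rw [h.level_a]; omega) hx.2.2
    exact ⟨z, mem_block.2 ⟨by omega, by omega, by omega⟩, hz3⟩
  · obtain ⟨t', h1, h2, h3, h4, h5⟩ : ∃ t', s ≤ t' ∧ t' ≤ a ∧
        (T.block (l + 1) t' a).card + 1 = σ.q ∧ (∀ y, t' ≤ y → y < a → T.level y ≠ l) ∧
        (r ∈ R → r ≠ σ.o → ∃ x ∈ T.block l s t', T.level x = l) := by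
      by_cases hno : ∀ y, s ≤ y → y < a → T.level y ≠ l
      · have hb := card_block_eq_succ (T := T) hsa hat h.level_a (honly s hno)
        have hb2 := card_block_add (T := T) (l := l + 1) hsa hat.le
        have hb3 := Finset.card_lt_card (Finset.ssubset_iff_subset_ne.2
          ⟨hXR, fun e => hon.2 (e ▸ hoR)⟩)
        obtain ⟨t', h1, h2, h3⟩ := exists_card_block_right (T := T) (l := l + 1) (k := σ.q - 1)
          hsa (by omega)
        exact ⟨t', h1, h2, by omega, fun y hy => hno y (by omega),
          fun hr hro => absurd ⟨hr, hro, hno⟩ hN⟩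
      · push Not at hno
        obtain ⟨y, hy1, hy2, hy3⟩ := hno
        obtain ⟨b, hyb, hb1, hb2, hbb⟩ := exists_last_of_level hy2 hy3
        have hp := h.prev b (by omega) (by omega) hb2 hbb
        have hql := σ.q_le
        have hbc : (T.block (l + 1) b a).card = (T.block (l + 1) (b + 1) a).card := by
          congr 1
          ext x
          simp only [mem_block]
          constructor
          · rintro ⟨h1, h2, h3⟩
            have : x ≠ b := by rintro rfl; omega
            exact ⟨by omega, h2, h3⟩
          · rintro ⟨h1, h2, h3⟩
            exact ⟨by omega, h2, h3⟩
        obtain ⟨t', h1, h2, h3⟩ := exists_card_block_right (T := T) (l := l + 1) (k := σ.q - 1)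
          (s := b + 1) (e := a) (by omega) (by omega)
        exact ⟨t', by omega, h2, by omega, fun y hy hya => hbb y (by omega) hya, fun _ _ =>
          ⟨b, mem_block.2 ⟨by omega, by omega, hb2.ge⟩, hb2⟩⟩
    have hb := card_block_add (T := T) (l := l + 1) h2 hat.le
    obtain ⟨f, hf, hfo, hfr, -⟩ := exists_emb_of_last (T := T) (G := G) ihR (o := σ.o) (r := r)
      (k := σ.o) (X := σ.X) (s := s) (t := t') (e := t) (u := a) (by omega)
      (h.unique.mono le_rfl (by omega)) h1 h2 hat h.level_a (honly t' h4) hoR hXR hon.2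
      (fun x hx y hy hyX hxy => by
        rcases σ.out_X x hx y (hRS hy) hyX hxy with rfl | rfl
        · exact absurd hy hzR
        · rfl)
      (by omega) (by omega) hrn.2 h5
    exact ⟨f, hf, Or.inl hfo, hfr⟩

end DFSTree

namespace DFSTree

variable {N : ℕ} {T : DFSTree N} {V : Type*} [DecidableEq V] {G : SimpleGraph V}

theorem exists_emb_of_split {S : Finset V} {r : V} {l s a u e L : ℕ} (h : CousinPair T l s a u e L)
    (ih : ∀ S' : Finset V, S'.card < S.card → T.Packs G S')
    (σ : TwoVertexSplit G S r (T.block (l + 1) u e).card L) (hSc : (T.block l s e).card = S.card) :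
    ∃ f, IsEmb G (T.graph 2) S (T.block l s e) f ∧ (r ∈ S → T.level (f r) = l) := by
  have hue := h.u_lt
  have heN := h.e_le
  have hsa := h.s_le
  have hau := h.a_lt
  have hla := h.level_a
  have hlu := h.level_u
  have hm := σ.m_lt
  have hbet := h.card_between
  have hzn := σ.z_notMem
  have hrn := σ.r_notMem
  simp only [Finset.mem_union, not_or] at hzn hrn
  have hskip : T.block (l + 1) (a + 1) u = T.block (l + 1) a u := by
    ext x
    simp only [mem_block]
    constructor
    · rintro ⟨h1, h2, h3⟩; exact ⟨by omega, h2, h3⟩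
    · rintro ⟨h1, h2, h3⟩
      have : x ≠ a := by rintro rfl; omega
      exact ⟨by omega, h2, h3⟩
  obtain ⟨t, ht1, ht2, ht3⟩ := exists_card_block_right (T := T) (l := l + 1) (k := σ.m)
    (s := a + 1) (e := u) (by omega) (by rw [hskip]; omega)
  obtain ⟨f, hf, hfc, hfk⟩ := exists_emb_right h ih σ (by omega : a < t) ht2 ht3
  obtain ⟨g, hg, hgo, hgr⟩ := exists_emb_left h ih σ (by omega : a < t) ht2 ht3 hSc
  have hE : σ.A ∪ σ.K.biUnion σ.D ⊆ S.erase σ.z := by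
    intro x hx
    rw [Finset.mem_union] at hx
    rw [Finset.mem_erase]
    constructor
    · rintro rfl; tauto
    · exact hx.elim (fun h => σ.A_sub h) fun h => σ.U_sub h
  have hlevel : ∀ x ∈ σ.A ∪ σ.K.biUnion σ.D,
      ∀ y ∈ S.erase σ.z \ (σ.A ∪ σ.K.biUnion σ.D), G.Adj x y →
        y = σ.o ∧ T.level (f x) = l + 1 := by
    intro x hx y hy hxy
    simp only [Finset.mem_sdiff, Finset.mem_erase, Finset.mem_union, not_or] at hx hy
    obtain ⟨⟨hyz, hyS⟩, hyA, hyU⟩ := hy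
    rcases hx with hx | hx
    · rcases σ.out_A x hx y hyS hyA hxy with h1 | ⟨h1, rfl⟩
      · exact absurd h1 hyz
      · exact ⟨h1, hfc hx⟩
    · obtain ⟨k, hk, hxk⟩ := Finset.mem_biUnion.1 hx
      rcases σ.out_D k hk x hxk y hyS
        (fun hyk => hyU (Finset.mem_biUnion.2 ⟨k, hk, hyk⟩)) hxy with h1 | ⟨h1, rfl⟩
      · exact absurd h1 hyz
      · exact ⟨h1, hfk x hk hxk⟩
  obtain ⟨F, hF, hF1, hF2⟩ := hf.union hg Finset.disjoint_sdiff
    (by rw [Finset.disjoint_left]; intro x; simp only [mem_block]; omega)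
    (fun x hx y hy hxy => by
      obtain ⟨rfl, hlx⟩ := hlevel x hx y hy hxy
      have hfx := mem_block.1 (hf.maps x hx)
      have hgy := mem_block.1 (hg.maps _ hy)
      symm
      rcases hgo with hgo | hgo
      · rw [hgo]
        rcases lt_trichotomy (f x) u with hlt | heq | hgt
        · exact adj_last (by omega) (h.unique.mono le_rfl hue.le) hau hla h.between
            (mem_block.2 ⟨by omega, hlt, by omega⟩) (by omega)
        · rw [heq] at hlx; omega
        · exact adj_nlc_parent (by omega) hgt h.nlc (by omega) fun z hz1 hz2 => by
            rw [hlu]; exact h.after z hz1 (by omega)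
      · exact adj_of_level_succ heN h.unique hgy.1 (by omega) hfx.2.1 hgo hlx)
  rw [Finset.union_sdiff_of_subset hE] at hF
  have hsub : T.block (l + 1) t e ∪ T.block l s t ⊆ T.block l s e :=
    Finset.union_subset (block_mono (by omega) (by omega) le_rfl)
      (block_mono le_rfl le_rfl (by omega))
  have hun : u ∉ T.block (l + 1) t e ∪ T.block l s t := by
    simp only [Finset.mem_union, mem_block]; omega
  obtain ⟨Φ, hΦ, hΦz, hΦS⟩ := hF.insert (Finset.notMem_erase σ.z S) hun fun x hx _ =>
    adj_last heN h.unique hue hlu h.after (hsub (hF.maps x hx))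
      (by rintro rfl; exact hun (hF.maps x hx))
  rw [Finset.insert_erase σ.z_mem] at hΦ
  refine ⟨Φ, hΦ.mono (Finset.insert_subset (mem_block.2 ⟨by omega, hue, hlu.ge⟩) hsub), fun hr => ?_⟩
  by_cases hrz : r = σ.z
  · rw [hrz, hΦz, hlu]
  · have h1 : r ∈ S.erase σ.z := Finset.mem_erase.2 ⟨hrz, hr⟩
    have h2 : r ∈ S.erase σ.z \ (σ.A ∪ σ.K.biUnion σ.D) := by
      rw [Finset.mem_sdiff, Finset.mem_union]; exact ⟨h1, by tauto⟩
    rw [hΦS r h1, hF2 r h2]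
    exact hgr h2

theorem exists_emb_of_hit {S : Finset V} {r : V} {l s a u e L : ℕ} (h : CousinPair T l s a u e L)
    (ih : ∀ S' : Finset V, S'.card < S.card → T.Packs G S')
    (hH : HasHit G S r (T.block (l + 1) u e).card L) (hSc : (T.block l s e).card = S.card) :
    ∃ f, IsEmb G (T.graph 2) S (T.block l s e) f ∧ (r ∈ S → T.level (f r) = l) := by
  obtain ⟨w, hw, F, hFS, hwF, hrF, hlo, hhi, hout⟩ := hH
  have hue := h.u_lt
  have hsa := h.s_le
  have hau := h.a_lt
  have hla := h.level_a
  have hbet := h.card_between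
  have hskip : T.block (l + 1) (a + 1) u = T.block (l + 1) a u := by
    ext x
    simp only [mem_block]
    constructor
    · rintro ⟨h1, h2, h3⟩; exact ⟨by omega, h2, h3⟩
    · rintro ⟨h1, h2, h3⟩
      have : x ≠ a := by rintro rfl; omega
      exact ⟨by omega, h2, h3⟩
  obtain ⟨t, ht1, ht2, ht3⟩ := exists_card_block_right (T := T) (l := l + 1)
    (k := F.card - (T.block (l + 1) u e).card) (s := a + 1) (e := u) (by omega)
    (by rw [hskip]; omega)
  have hc := card_block_add (T := T) (l := l + 1) ht2 hue.le
  obtain ⟨f, hf, -, hfr, -⟩ := exists_emb_of_last (T := T) (G := G) ih (o := w) (r := r)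
    (k := w) (X := F) (s := s) (t := t) (e := e) (u := u) h.e_le h.unique (by omega) ht2 hue
    h.level_u (fun y hy1 hy2 hy3 => by
      rcases lt_trichotomy y u with hlt | heq | hgt
      · exact absurd hy3 (h.between y (by omega) hlt)
      · exact heq
      · exact absurd hy3 (h.after y hgt (by omega)))
    hw hFS hwF hout (by omega) hSc hrF
    fun _ _ => ⟨a, mem_block.2 ⟨by omega, by omega, hla.ge⟩, hla⟩
  exact ⟨f, hf, hfr⟩

/-- The embedding, for a block which has a vertex on its top level. -/
theorem exists_emb_of_level (hT : T.IsKSTree 4 1) (hG : LeafyGraph G) {S : Finset V} {r : V}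
    {l s e y : ℕ} (ih : ∀ S' : Finset V, S'.card < S.card → T.Packs G S') (he : e ≤ N)
    (hU : T.UniqueAbove l s e) (hSc : (T.block l s e).card = S.card) (hsy : s ≤ y) (hye : y < e)
    (hy : T.level y = l) (hr : r ∈ S) :
    ∃ f, IsEmb G (T.graph 2) S (T.block l s e) f ∧ (r ∈ S → T.level (f r) = l) := by
  obtain ⟨u, hyu, hue, hu, haft⟩ := exists_last_of_level hye hy
  have hre := Finset.card_erase_add_one hr
  by_cases hno : ∀ z, s ≤ z → z < u → T.level z ≠ l
  · have honly : ∀ z, s ≤ z → z < e → T.level z = l → z = u := by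
      intro z hz1 hz2 hz3
      rcases lt_trichotomy z u with hlt | heq | hgt
      · exact absurd hz3 (hno z hz1 hlt)
      · exact heq
      · exact absurd hz3 (haft z hgt hz2)
    have hc := card_block_eq_succ (T := T) (by omega) hue hu honly
    obtain ⟨f, hf, -, hfr, -⟩ := exists_emb_of_last (T := T) (G := G) ih (o := r) (r := r)
      (k := r) (X := S.erase r) (s := s) (t := s) (e := e) (u := u) he hU le_rfl (by omega) hue
      hu honly hr (Finset.erase_subset _ _) (Finset.notMem_erase _ _)
      (fun x _ z hz hzX _ => by
        by_contra hne; exact hzX (Finset.mem_erase.2 ⟨hne, hz⟩))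
      (by omega) hSc (Finset.notMem_erase _ _) (fun _ hne => absurd rfl hne)
    exact ⟨f, hf, hfr⟩
  push Not at hno
  obtain ⟨z, hz1, hz2, hz3⟩ := hno
  obtain ⟨a, hza, hau, ha, hbet⟩ := exists_last_of_level hz2 hz3
  have honly : ∀ z, u ≤ z → z < e → T.level z = l → z = u := by
    intro z hz1 hz2 hz3
    rcases hz1.eq_or_lt with heq | hgt
    · exact heq.symm
    · exact absurd hz3 (haft z hgt hz2)
  rcases (T.block (l + 1) u e).eq_empty_or_nonempty with hB | hB
  · obtain ⟨f, hf, -, hfr, -⟩ := exists_emb_of_last (T := T) (G := G) ih (o := r) (r := r)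
      (k := r) (X := ∅) (s := s) (t := u) (e := e) (u := u) he hU (by omega) le_rfl hue
      hu honly hr (by simp) (by simp) (by simp) (by rw [hB]; rfl) hSc (by simp)
      (fun _ hne => absurd rfl hne)
    exact ⟨f, hf, hfr⟩
  obtain ⟨L, h⟩ := exists_cousinPair hT he hU (by omega) hau hue ha hu hbet haft hB
  have hc1 := card_block_eq_succ (T := T) le_rfl hue hu honly
  have hc2 := card_block_add (T := T) (l := l) (by omega : s ≤ u) hue.le
  rcases hasHit_or_split (hG.rTree hr) h.L_pos h.card_after (by omega) with hH | ⟨⟨σ⟩⟩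
  · exact exists_emb_of_hit h ih hH hSc
  · exact exists_emb_of_split h ih σ hSc

theorem packs (hT : T.IsKSTree 4 1) (hG : LeafyGraph G) (S : Finset V) : T.Packs G S := by
  induction hn : S.card using Nat.strong_induction_on generalizing S with
  | _ n IH =>
    have ih : ∀ S' : Finset V, S'.card < S.card → T.Packs G S' := fun S' h =>
      IH _ (by omega) S' rfl
    intro l s e he hU hSc r
    rcases S.eq_empty_or_nonempty with rfl | ⟨r₀, hr₀⟩
    · exact ⟨fun _ => 0, ⟨by simp, by simp, by simp⟩, by simp⟩
    obtain ⟨r₁, hr₁, hrr⟩ : ∃ r₁ ∈ S, r ∈ S → r = r₁ := by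
      by_cases hr : r ∈ S
      · exact ⟨r, hr, fun _ => rfl⟩
      · exact ⟨r₀, hr₀, fun h => absurd h hr⟩
    by_cases hx : ∃ x ∈ T.block l s e, T.level x = l
    · obtain ⟨x, hx, hxl⟩ := hx
      rw [mem_block] at hx
      obtain ⟨f, hf, hfr⟩ := exists_emb_of_level hT hG ih he hU hSc hx.1 hx.2.1 hxl hr₁
      exact ⟨f, hf, fun hr _ => by rw [hrr hr]; exact hfr hr₁⟩
    · have hne : (T.block l s e).Nonempty := by
        rw [← Finset.card_pos, hSc]; exact Finset.card_pos.2 ⟨r₀, hr₀⟩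
      obtain ⟨x, hxB, hmin⟩ := Finset.exists_min_image _ T.level hne
      have hx' := mem_block.1 hxB
      have hlx : l < T.level x := lt_of_le_of_ne hx'.2.2 fun h => hx ⟨x, hxB, h.symm⟩
      have hblock : T.block (T.level x) s e = T.block l s e := by
        ext z
        simp only [mem_block]
        constructor
        · rintro ⟨h1, h2, h3⟩; exact ⟨h1, h2, by omega⟩
        · rintro ⟨h1, h2, h3⟩
          exact ⟨h1, h2, hmin z (mem_block.2 ⟨h1, h2, h3⟩)⟩
      have hU' : T.UniqueAbove (T.level x) s e := by
        intro y z h1 h2 h3 h4 h5 h6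
        have := hmin y (mem_block.2 ⟨h1, h2, by omega⟩)
        omega
      obtain ⟨f, hf, -⟩ := exists_emb_of_level hT hG ih he hU' (by rw [hblock, hSc]) hx'.1
        hx'.2.1 rfl hr₁
      exact ⟨f, hblock ▸ hf, fun _ h => absurd h hx⟩

end DFSTree

/-- In a tree, a vertex of a finite set at maximal distance from a fixed vertex has at most one
neighbour in the set. -/
theorem leafyGraph_of_isTree {V : Type*} {G : SimpleGraph V} (h : G.IsTree) : LeafyGraph G := by
  intro S hS
  obtain ⟨v, -⟩ := id hS
  obtain ⟨x, hx, hmax⟩ := Finset.exists_max_image S (G.dist v) hS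
  obtain ⟨p, hp, hpl⟩ := h.connected.exists_path_of_dist v x
  have key : ∀ w ∈ S, G.Adj x w → w = p.penultimate := fun w hw hxw => by
    obtain ⟨q, hq, hql⟩ := h.connected.exists_path_of_dist v w
    refine h.isAcyclic.eq_penultimate_of_adj_end hp hxw
      (h.isAcyclic.mem_support_of_ne_mem_support_of_adj_of_isPath hp hq hxw fun hxq => ?_)
    have hlen := congrArg SimpleGraph.Walk.length (h.isAcyclic.path_concat hp hq hxw hxq)
    rw [SimpleGraph.Walk.length_concat] at hlen
    have := hmax w hw
    omega
  exact ⟨x, hx, fun y hy z hz hxy hxz => (key y hy hxy).trans (key z hz hxz).symm⟩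

/-- For every `(4,1)`-tree `T` on `N` vertices (with DFS preorder `0, …, N-1`) and all
`i, m ≥ 0` with `i + m ≤ N`, the induced subgraph of `G²_T` on the interval
`{i, …, i+m-1}` contains every tree on `m` vertices. -/
theorem statement9 (N : ℕ) (T : DFSTree N) (hT : T.IsKSTree 4 1)
    (i m : ℕ) (him : i + m ≤ N) (Tr : SimpleGraph (Fin m)) (hTr : Tr.IsTree) :
    ∃ f : Fin m → ℕ, Function.Injective f ∧ (∀ a, i ≤ f a ∧ f a < i + m) ∧
      ∀ a b, Tr.Adj a b → (T.graph 2).Adj (f a) (f b) := by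
  obtain ⟨f, hf, -⟩ := DFSTree.packs hT (leafyGraph_of_isTree hTr) Finset.univ 0 i (i + m) him
    (fun x y _ _ _ _ h => by omega) (by simp [DFSTree.block]) hTr.connected.nonempty.some
  refine ⟨f, fun x y h => hf.inj x (by simp) y (by simp) h, fun a => ?_, fun a b h =>
    hf.adj a (by simp) b (by simp) h⟩
  have := DFSTree.mem_block.1 (hf.maps a (by simp))
  exact ⟨this.1, this.2.1⟩
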